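/- (Logvinenko–Sereda theorem on the torus, single parallelepiped) There is a universal constant c > 0 such that the following holds. Let d ≥ 1, L > 0, p ∈ [1,∞], and let f ∈ L^p(T^d_L) with T^d_L = [0,2πL]^d have Fourier coefficients supported in an axis-parallel parallelepiped J ⊂ R^d with side lengths b_1, ..., b_d. Let S ⊂ R^d be (γ,a)-thick with 0 < a_j ≤ 2πL for all j. Then ‖f‖_{L^p(T^d_L)} ≤ (c^d/γ)^{c a·b + (6d+1)/p} ‖f‖_{L^p(S ∩ T^d_L)}, where a·b = Σ_j a_j b_j (for p = ∞ the exponent is c a·b). -/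

import Mathlib

open MeasureTheory Real

/-- The trigonometric polynomial on `T^d_L` with Fourier coefficients `F` supported on `T`. -/
noncomputable def trigPoly {d : ℕ} (L : ℝ) (T : Finset (Fin d → ℤ)) (F : (Fin d → ℤ) → ℂ) :
    (Fin d → ℝ) → ℂ :=
  fun x => ∑ k ∈ T, F k * Complex.exp (Complex.I * ((∑ j, x j * (k j : ℝ) / L : ℝ) : ℂ))

/-- The fundamental domain `[0, 2πL]^d` of the torus `T^d_L`. -/
def torusCube (d : ℕ) (L : ℝ) : Set (Fin d → ℝ) :=
  Set.univ.pi fun _ : Fin d => Set.Icc (0 : ℝ) (2 * π * L)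

/-- Partial fractions for a product of distinct linear factors. -/
theorem inv_prod_sub_eq_sum {ι : Type*} [Fintype ι] [DecidableEq ι] [Nonempty ι] (v : ι → ℂ)
    (hv : Function.Injective v) (z : ℂ) (hz : ∀ i, z ≠ v i) :
    (∏ i, (z - v i))⁻¹ = ∑ i, (∏ j ∈ Finset.univ.erase i, (v i - v j)⁻¹) * (z - v i)⁻¹ := by
  have h := congrArg (Polynomial.eval z)
    (Lagrange.sum_basis (s := Finset.univ) (v := v) hv.injOn Finset.univ_nonempty)
  rw [Polynomial.eval_finsetSum, Polynomial.eval_one, Finset.sum_congr rfl fun i hi =>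
    Lagrange.eval_basis_not_at_node hi (hz i), ← Finset.mul_sum, Lagrange.eval_nodal] at h
  exact inv_eq_of_mul_eq_one_right h

theorem norm_le_of_interpolation {n : ℕ} (t : Fin n → ℝ) (ht : Function.Injective t)
    (ht0 : ∀ i, 0 < t i) (ht1 : ∀ i, t i ≤ 1) {φ : ℂ → ℂ} (hφ : Differentiable ℂ φ) {B δ : ℝ}
    (hB : ∀ z : ℂ, ‖z‖ ≤ 3 → ‖φ z‖ ≤ B) (hδ : ∀ i, ‖φ (t i)‖ ≤ δ) :
    ‖φ 0‖ ≤ ∑ i, (∏ j ∈ Finset.univ.erase i, |t i - t j|⁻¹) * δ + B / 2 ^ n := by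
  set v : Option (Fin n) → ℂ := fun o => o.elim 0 (fun i => (t i : ℂ)) with hv
  have hvinj : Function.Injective v := by
    rintro (_ | i) (_ | j) h
    · rfl
    · exact absurd (by simpa [hv] using h.symm) (ht0 j).ne'
    · exact absurd (by simpa [hv] using h) (ht0 i).ne'
    · simp only [hv, Option.elim_some, Complex.ofReal_inj] at h
      rw [ht h]
  have hvn : ∀ o, ‖v o‖ ≤ 1 := by
    rintro (_ | i)
    · simp [hv]
    · simpa [hv, abs_of_pos (ht0 i)] using ht1 i
  have hne : ∀ z ∈ Metric.sphere (0 : ℂ) 3, ∀ o, z ≠ v o := by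
    intro z hz o h
    have h1 := hvn o
    rw [← h, mem_sphere_zero_iff_norm.1 hz] at h1
    norm_num at h1
  set w : Option (Fin n) → ℂ := fun o => ∏ j ∈ Finset.univ.erase o, (v o - v j)⁻¹ with hw
  have hint : ∮ z in C(0, 3), (∏ o, (z - v o))⁻¹ • φ z = ∑ o, w o * ((2 * π * Complex.I) * φ (v o)) := by
    have h1 : ∮ z in C(0, 3), (∏ o, (z - v o))⁻¹ • φ z
        = ∮ z in C(0, 3), ∑ o, w o * ((z - v o)⁻¹ • φ z) := by
      refine circleIntegral.integral_congr (by norm_num) fun z hz => ?_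
      simp only [inv_prod_sub_eq_sum v hvinj z (hne z hz), smul_eq_mul, Finset.sum_mul, hw, mul_assoc]
    rw [h1, circleIntegral.integral_fun_sum]
    · refine Finset.sum_congr rfl fun o _ => ?_
      rw [circleIntegral.integral_const_mul, DiffContOnCl.circleIntegral_sub_inv_smul, smul_eq_mul]
      · exact hφ.diffContOnCl
      · rw [mem_ball_zero_iff]
        exact (hvn o).trans_lt (by norm_num)
    · intro o _
      refine ContinuousOn.circleIntegrable (by norm_num) ?_
      refine continuousOn_const.mul (ContinuousOn.smul (ContinuousOn.inv₀
        (continuousOn_id.sub continuousOn_const) ?_) hφ.continuous.continuousOn)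
      exact fun z hz => sub_ne_zero.2 (hne z hz o)
  have hbd : ‖∑ o, w o * ((2 * π * Complex.I) * φ (v o))‖ ≤ 2 * π * 3 * (B / (3 * 2 ^ n)) := by
    rw [← hint]
    refine circleIntegral.norm_integral_le_of_norm_le_const (by norm_num) fun z hz => ?_
    have hz3 := mem_sphere_zero_iff_norm.1 hz
    have h1 : (3 : ℝ) * 2 ^ n ≤ ‖∏ o, (z - v o)‖ := by
      rw [norm_prod, Fintype.prod_option]
      have : (2 : ℝ) ^ n = ∏ _i : Fin n, 2 := by simp
      rw [this]
      gcongr with i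
      · simp [hv, hz3]
      · have := norm_sub_norm_le z (v (some i))
        linarith [hvn (some i)]
    rw [norm_smul, norm_inv, inv_mul_eq_div]
    have := hB z hz3.le
    have hB0 := (norm_nonneg _).trans this
    gcongr
  have hfac : ∑ o, w o * ((2 * π * Complex.I) * φ (v o)) = (2 * π * Complex.I) * ∑ o, w o * φ (v o) := by
    rw [Finset.mul_sum]
    exact Finset.sum_congr rfl fun o _ => by ring
  have hbd2 : ‖∑ o, w o * φ (v o)‖ ≤ B / 2 ^ n := by
    rw [hfac, norm_mul] at hbd
    have h2 : ‖(2 * π * Complex.I : ℂ)‖ = 2 * π := by simp [abs_of_pos pi_pos]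
    rw [h2] at hbd
    have h3 : 2 * π * 3 * (B / (3 * 2 ^ n)) = 2 * π * (B / 2 ^ n) := by field_simp
    rw [h3] at hbd
    exact le_of_mul_le_mul_left hbd (by positivity)
  rw [Fintype.sum_option] at hbd2
  set P : ℂ := ∏ i, (t i : ℂ) with hP
  have hP1 : ‖P‖ ≤ 1 := by
    rw [hP, norm_prod]
    exact Finset.prod_le_one (fun _ _ => norm_nonneg _) fun i _ => hvn (some i)
  have hw0 : ‖w none‖ * ‖P‖ = 1 := by
    have he : (Finset.univ : Finset (Option (Fin n))).erase none
        = Finset.univ.map Function.Embedding.some := by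
      ext (_ | i) <;> simp
    rw [← norm_mul, hw, hP]
    simp only [he, Finset.prod_map, ← Finset.prod_mul_distrib, norm_prod]
    refine Finset.prod_eq_one fun i _ => ?_
    have := (ht0 i).ne'
    simp [hv, this]
  have hws : ∀ i, ‖w (some i)‖ * ‖P‖ ≤ ∏ j ∈ Finset.univ.erase i, |t i - t j|⁻¹ := by
    intro i
    have he : (Finset.univ : Finset (Option (Fin n))).erase (some i)
        = Finset.insertNone (Finset.univ.erase i) := by
      ext (_ | j) <;> simp
    simp only [hw, hP]
    rw [he, Finset.prod_insertNone, norm_mul, norm_prod, norm_prod,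
      ← Finset.mul_prod_erase Finset.univ _ (Finset.mem_univ i)]
    have h0 := (ht0 i).ne'
    have h7 : ‖(v (some i) - v none)⁻¹‖ * ‖(t i : ℂ)‖ = 1 := by
      rw [← norm_mul]
      simp [hv, h0]
    calc _ = (‖(v (some i) - v none)⁻¹‖ * ‖(t i : ℂ)‖) *
        ((∏ j ∈ Finset.univ.erase i, ‖(v (some i) - v (some j))⁻¹‖) *
          ∏ j ∈ Finset.univ.erase i, ‖(t j : ℂ)‖) := by ring
      _ = ∏ j ∈ Finset.univ.erase i, ‖(v (some i) - v (some j))⁻¹‖ * ‖(t j : ℂ)‖ := by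
        rw [h7, one_mul, Finset.prod_mul_distrib]
      _ ≤ _ := by
        refine Finset.prod_le_prod (fun _ _ => by positivity) fun j _ => ?_
        have h8 : ‖(v (some i) - v (some j))⁻¹‖ = |t i - t j|⁻¹ := by
          simp only [hv, Option.elim_some]
          rw [← Complex.ofReal_sub, norm_inv, Complex.norm_real, Real.norm_eq_abs]
        rw [h8]
        exact mul_le_of_le_one_right (by positivity) (hvn (some j))
  have h5 : ‖w none * φ 0‖ ≤ ∑ i, ‖w (some i)‖ * δ + B / 2 ^ n := by
    have h6 : w none * φ 0 = (w none * φ (v none) + ∑ i, w (some i) * φ (v (some i)))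
      - ∑ i, w (some i) * φ (v (some i)) := by simp [hv]
    rw [h6]
    refine (norm_sub_le _ _).trans ?_
    rw [add_comm]
    gcongr
    refine (norm_sum_le _ _).trans ?_
    gcongr with i
    rw [norm_mul]
    gcongr
    exact hδ i
  have hB0 : 0 ≤ B := (norm_nonneg _).trans (hB 0 (by simp))
  calc ‖φ 0‖ = ‖w none * φ 0‖ * ‖P‖ := by rw [norm_mul, mul_right_comm, hw0, one_mul]
    _ ≤ (∑ i, ‖w (some i)‖ * δ + B / 2 ^ n) * ‖P‖ := by gcongr
    _ = ∑ i, ‖w (some i)‖ * ‖P‖ * δ + B / 2 ^ n * ‖P‖ := by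
      rw [add_mul, Finset.sum_mul]
      congr 1
      exact Finset.sum_congr rfl fun i _ => by ring
    _ ≤ _ := by
      gcongr with i
      · exact (norm_nonneg _).trans (hδ i)
      · exact hws i
      · exact mul_le_of_le_one_right (by positivity) hP1

theorem exists_separated_points {h : ℝ} (hh : 0 < h) (n : ℕ) (E : Set ℝ) (hE : BddBelow E)
    (hvol : ENNReal.ofReal (n * h) < volume E) :
    ∃ t : ℕ → ℝ, (∀ i ≤ n, t i ∈ E) ∧ ∀ i < n, t i + h ≤ t (i + 1) := by
  induction n generalizing E with
  | zero =>
    obtain ⟨x, hx⟩ := nonempty_of_measure_ne_zero (bot_le.trans_lt hvol).ne'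
    exact ⟨fun _ => x, fun _ _ => hx, fun i hi => absurd hi (Nat.not_lt_zero i)⟩
  | succ n ih =>
    obtain ⟨x, hx⟩ := nonempty_of_measure_ne_zero (bot_le.trans_lt hvol).ne'
    obtain ⟨r, hr0, hr1, hr2⟩ := ENNReal.lt_iff_exists_real_btwn.1 hvol
    rw [ENNReal.ofReal_lt_ofReal_iff_of_nonneg (by positivity)] at hr1
    obtain ⟨y, hy, hys⟩ := exists_lt_of_csInf_lt ⟨x, hx⟩
      (show sInf E < sInf E + (r - ((n + 1 : ℕ) : ℝ) * h) by linarith)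
    have hsub : E ⊆ Set.Icc (sInf E) (y + h) ∪ (E ∩ Set.Ici (y + h)) := by
      intro z hz
      rcases le_total z (y + h) with h1 | h1
      · exact Or.inl ⟨csInf_le hE hz, h1⟩
      · exact Or.inr ⟨hz, h1⟩
    have hvol' : ENNReal.ofReal (n * h) < volume (E ∩ Set.Ici (y + h)) := by
      by_contra! hcon
      have h2 : volume E ≤ ENNReal.ofReal (y + h - sInf E) + ENNReal.ofReal (n * h) := by
        refine (measure_mono hsub).trans ((measure_union_le _ _).trans ?_)
        rw [Real.volume_Icc]
        gcongr
      have h3 := csInf_le hE hy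
      rw [← ENNReal.ofReal_add (by linarith) (by positivity)] at h2
      refine absurd (hr2.trans_le (h2.trans (ENNReal.ofReal_le_ofReal ?_))) (lt_irrefl _)
      push_cast at hys
      linarith
    obtain ⟨t, ht, hts⟩ := ih _ (hE.mono Set.inter_subset_left) hvol'
    refine ⟨fun i => Nat.casesOn i y t, ?_, ?_⟩
    · rintro (_ | i) hi
      · exact hy
      · exact (ht i (by omega)).1
    · rintro (_ | i) hi
      · exact (ht 0 (by omega)).2
      · exact hts i (by omega)

theorem add_mul_le_of_separated {h : ℝ} {n : ℕ} {t : ℕ → ℝ} (ht : ∀ i < n, t i + h ≤ t (i + 1))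
    (i k : ℕ) (hik : i + k ≤ n) : t i + k * h ≤ t (i + k) := by
  induction k with
  | zero => simp
  | succ k ih =>
    have h1 := ih (by omega)
    have h2 := ht (i + k) (by omega)
    rw [← add_assoc]
    push_cast
    linarith

theorem mul_abs_sub_le_of_separated {h : ℝ} (hh : 0 ≤ h) {n : ℕ} {t : ℕ → ℝ}
    (ht : ∀ i < n, t i + h ≤ t (i + 1)) {i j : ℕ} (hi : i ≤ n) (hj : j ≤ n) :
    h * |(i : ℝ) - j| ≤ |t i - t j| := by
  wlog hij : i ≤ j generalizing i j
  · rw [abs_sub_comm, abs_sub_comm (t i)]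
    exact this hj hi (le_of_not_ge hij)
  obtain ⟨k, rfl⟩ := Nat.exists_eq_add_of_le hij
  have := add_mul_le_of_separated ht i k hj
  have hk : (0 : ℝ) ≤ k * h := by positivity
  rw [abs_of_nonpos (a := t i - _) (by linarith), abs_of_nonpos (by push_cast; linarith [k.cast_nonneg (α := ℝ)])]
  push_cast
  linarith

theorem prod_range_abs_sub_eq_factorial (i m : ℕ) :
    ∏ j ∈ Finset.range (i + m + 1), (if j = i then 1 else |(i : ℝ) - j|)
      = (i.factorial : ℝ) * m.factorial := by
  induction m with
  | zero =>
    rw [Finset.prod_range_succ, if_pos rfl, ← Finset.prod_range_add_one_eq_factorial,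
      ← Finset.prod_range_reflect]
    push_cast
    simp only [Nat.factorial_zero, Nat.cast_one, mul_one]
    refine Finset.prod_congr rfl fun j hj => ?_
    have hj := Finset.mem_range.1 hj
    obtain ⟨k, rfl⟩ := Nat.exists_eq_add_of_lt hj
    rw [if_neg (by omega), show j + k + 1 - 1 - j = k by omega]
    push_cast
    rw [show (j : ℝ) + k + 1 - k = j + 1 by ring, abs_of_nonneg (by positivity)]
  | succ m ih =>
    rw [← add_assoc, Finset.prod_range_succ, ih, if_neg (by omega), Nat.factorial_succ]
    have : |(i : ℝ) - ((i + m + 1 : ℕ) : ℝ)| = m + 1 := by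
      rw [abs_of_nonpos (by push_cast; linarith [m.cast_nonneg (α := ℝ)])]
      push_cast
      ring
    rw [this]
    push_cast
    ring

theorem prod_inv_abs_sub_le {n : ℕ} {t : ℕ → ℝ} {h : ℝ} (hh : 0 < h)
    (ht : ∀ i < n, t i + h ≤ t (i + 1)) (i : Fin (n + 1)) :
    ∏ j ∈ Finset.univ.erase i, |t i - t j|⁻¹ ≤ (2 / h) ^ n / n.factorial := by
  obtain ⟨m, hm⟩ : ∃ m, n = i + m := Nat.exists_eq_add_of_le (Nat.lt_succ_iff.1 i.2)
  have h1 : ∏ j ∈ Finset.univ.erase i, (h⁻¹ * |((i : ℕ) : ℝ) - (j : ℕ)|⁻¹)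
      = (h ^ n)⁻¹ * (((i : ℕ).factorial : ℝ) * m.factorial)⁻¹ := by
    rw [Finset.prod_mul_distrib, Finset.prod_const, Finset.card_erase_of_mem (Finset.mem_univ i),
      Finset.card_univ, Fintype.card_fin, inv_pow, Nat.add_sub_cancel,
      ← prod_range_abs_sub_eq_factorial, ← hm, ← Finset.prod_inv_distrib,
      ← Fin.prod_univ_eq_prod_range
        (fun j => (if j = (i : ℕ) then (1 : ℝ) else |((i : ℕ) : ℝ) - j|)⁻¹) (n + 1),
      ← Finset.prod_erase Finset.univ (a := i) (by simp)]
    congr 1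
    refine Finset.prod_congr rfl fun j hj => ?_
    rw [if_neg (fun h => Finset.ne_of_mem_erase hj (Fin.ext h))]
  have h2 : (n.factorial : ℝ) ≤ 2 ^ n * (((i : ℕ).factorial : ℝ) * m.factorial) := by
    have h3 := Nat.choose_mul_factorial_mul_factorial (n := n) (k := i) (by omega)
    rw [show n - (i : ℕ) = m by omega] at h3
    have h4 := Nat.choose_le_two_pow n i
    rw [← h3, mul_assoc]
    push_cast
    gcongr
    exact_mod_cast h4
  calc ∏ j ∈ Finset.univ.erase i, |t i - t j|⁻¹
      ≤ ∏ j ∈ Finset.univ.erase i, (h⁻¹ * |((i : ℕ) : ℝ) - (j : ℕ)|⁻¹) := by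
        refine Finset.prod_le_prod (fun _ _ => by positivity) fun j hj => ?_
        rw [← mul_inv]
        have : (0 : ℝ) < |((i : ℕ) : ℝ) - (j : ℕ)| := by
          rw [abs_pos, sub_ne_zero]
          exact fun h => Finset.ne_of_mem_erase hj (Fin.ext (by exact_mod_cast h.symm))
        exact inv_anti₀ (by positivity) (mul_abs_sub_le_of_separated hh.le ht
          (Nat.lt_succ_iff.1 i.2) (Nat.lt_succ_iff.1 j.2))
    _ = (h ^ n)⁻¹ * (((i : ℕ).factorial : ℝ) * m.factorial)⁻¹ := h1
    _ ≤ _ := by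
      rw [div_pow, div_div, ← mul_inv, inv_eq_one_div, div_le_div_iff₀ (by positivity) (by positivity)]
      calc _ = h ^ n * (n.factorial : ℝ) := by ring
        _ ≤ h ^ n * (2 ^ n * (((i : ℕ).factorial : ℝ) * m.factorial)) := by gcongr
        _ = _ := by ring

theorem norm_le_pow_mul_add {φ : ℂ → ℂ} (hφ : Differentiable ℂ φ) {B δ : ℝ}
    (hB : ∀ z : ℂ, ‖z‖ ≤ 3 → ‖φ z‖ ≤ B) {E : Set ℝ} (hE : E ⊆ Set.Icc 0 1) {e : ℝ} (he : 0 < e)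
    (hvol : ENNReal.ofReal e ≤ volume E) (hδ : ∀ t ∈ E, ‖φ t‖ ≤ δ) (n : ℕ) :
    ‖φ 0‖ ≤ (12 / e) ^ (n + 1) * δ + B / 2 ^ (n + 1) := by
  have he1 : e ≤ 1 := by
    have := hvol.trans (measure_mono hE)
    rw [Real.volume_Icc, ENNReal.ofReal_le_ofReal_iff (by norm_num)] at this
    linarith
  have hvol' : ENNReal.ofReal (n * (e / (n + 1))) < volume (E \ {0}) := by
    rw [measure_sdiff_null (measure_singleton 0)]
    refine lt_of_lt_of_le ?_ hvol
    rw [ENNReal.ofReal_lt_ofReal_iff he, mul_div_assoc', div_lt_iff₀ (by positivity)]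
    nlinarith
  obtain ⟨t, ht, hts⟩ := exists_separated_points (show 0 < e / (n + 1) by positivity) n (E \ {0})
    (bddBelow_Icc.mono (Set.sdiff_subset.trans hE)) hvol'
  have htE : ∀ i : Fin (n + 1), t i ∈ E \ {0} := fun i => ht i (Nat.lt_succ_iff.1 i.2)
  have hinj : Function.Injective fun i : Fin (n + 1) => t i := by
    intro i j hij
    have h1 := mul_abs_sub_le_of_separated (by positivity) hts (Nat.lt_succ_iff.1 i.2)
      (Nat.lt_succ_iff.1 j.2)
    simp only at hij
    rw [hij, sub_self, abs_zero] at h1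
    have h2 : |((i : ℕ) : ℝ) - (j : ℕ)| ≤ 0 := by
      by_contra! hc
      have : 0 < e / ((n : ℝ) + 1) * |((i : ℕ) : ℝ) - (j : ℕ)| := by positivity
      linarith
    have h3 := sub_eq_zero.1 (abs_nonpos_iff.1 h2)
    exact Fin.ext (by exact_mod_cast h3)
  have hδ0 : 0 ≤ δ := (norm_nonneg _).trans (hδ _ (htE 0).1)
  have hmain := norm_le_of_interpolation (fun i : Fin (n + 1) => t i) hinj
    (fun i => lt_of_le_of_ne (hE (htE i).1).1 (Ne.symm (htE i).2)) (fun i => (hE (htE i).1).2) hφ hB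
    (fun i => hδ _ (htE i).1)
  refine hmain.trans ?_
  gcongr
  rw [← Finset.sum_mul]
  gcongr
  calc ∑ i : Fin (n + 1), ∏ j ∈ Finset.univ.erase i, |t i - t j|⁻¹
      ≤ ∑ _i : Fin (n + 1), (2 / (e / (n + 1))) ^ n / n.factorial :=
        Finset.sum_le_sum fun i _ => prod_inv_abs_sub_le (by positivity) hts i
    _ = (n + 1) * (2 / e) ^ n * (((n + 1 : ℕ) : ℝ) ^ (n + 1) / (n + 1).factorial) := by
      rw [Finset.sum_const, Finset.card_univ, Fintype.card_fin, nsmul_eq_mul, Nat.factorial_succ]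
      push_cast
      have : (n.factorial : ℝ) ≠ 0 := by positivity
      field_simp
      rw [show ((n : ℝ) + 1) * 2 / e = 2 / e * (n + 1) by ring, mul_pow]
      ring
    _ ≤ 2 ^ (n + 1) * (2 / e) ^ (n + 1) * (3 ^ (n + 1)) := by
      gcongr
      · exact_mod_cast (Nat.lt_two_pow_self (n := n + 1)).le
      · rw [le_div_iff₀ he]
        linarith
      · omega
      · refine (Real.pow_div_factorial_le_exp _ (by positivity) (n + 1)).trans ?_
        rw [← mul_one (((n + 1 : ℕ) : ℝ)), Real.exp_nat_mul]
        gcongr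
        exact (Real.exp_one_lt_d9.trans (by norm_num)).le
    _ = (12 / e) ^ (n + 1) := by
      rw [← mul_pow, ← mul_pow]
      congr 1
      ring

theorem le_of_forall_pow_le_mul_pow {x y K : ℝ} (hy : 0 ≤ y)
    (h : ∀ N : ℕ, x ^ (N + 1) ≤ K * y ^ (N + 1)) : x ≤ y := by
  by_contra! hxy
  rcases hy.eq_or_lt with rfl | hy
  · have := h 0
    simp at this
    linarith
  obtain ⟨N, hN⟩ := pow_unbounded_of_one_lt K ((one_lt_div hy).2 hxy)
  have h1 := h N
  rw [← div_le_iff₀ (by positivity), ← div_pow] at h1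
  have h2 : (x / y) ^ N ≤ (x / y) ^ (N + 1) :=
    pow_le_pow_right₀ ((one_lt_div hy).2 hxy).le (Nat.le_succ N)
  linarith

/-- A Remez type inequality for entire functions of controlled growth. -/
theorem norm_le_rpow_mul_of_growth {φ : ℂ → ℂ} (hφ : Differentiable ℂ φ) {M δ : ℝ} (hM : 1 ≤ M)
    (hB : ∀ z : ℂ, ‖z‖ ≤ 3 → ‖φ z‖ ≤ M * ‖φ 0‖) {E : Set ℝ} (hE : E ⊆ Set.Icc 0 1) {e : ℝ}
    (he : 0 < e) (he1 : e ≤ 1) (hvol : ENNReal.ofReal e ≤ volume E) (hδ : ∀ t ∈ E, ‖φ t‖ ≤ δ) :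
    ‖φ 0‖ ≤ (12 / e) ^ (log M / log 2) * δ := by
  have hD : 1 ≤ 12 / e := by
    rw [le_div_iff₀ he]
    linarith
  obtain ⟨t₀, ht₀⟩ := nonempty_of_measure_ne_zero
    ((ENNReal.ofReal_pos.2 he).trans_le hvol).ne'
  have hδ0 : 0 ≤ δ := (norm_nonneg _).trans (hδ _ ht₀)
  have hl2 : 0 < log 2 := log_pos (by norm_num)
  have hlM : 0 ≤ log M := log_nonneg hM
  refine le_of_forall_pow_le_mul_pow (K := 2 * (12 / e) ^ (2 : ℕ)) 
    (by positivity) fun N => ?_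
  set s : ℝ := (N + 1 : ℕ) * (log M / log 2) with hs
  have hs0 : 0 ≤ s := by positivity
  have hn1 : s ≤ ⌈s⌉₊ := Nat.le_ceil s
  have hn2 : (⌈s⌉₊ : ℝ) < s + 1 := Nat.ceil_lt_add_one hs0
  set n := ⌈s⌉₊
  have h2s : M ^ (N + 1) = (2 : ℝ) ^ s := by
    rw [← Real.rpow_natCast, Real.rpow_def_of_pos (by linarith), Real.rpow_def_of_pos two_pos, hs]
    congr 1
    field_simp
  have h2n : M ^ (N + 1) ≤ 2 ^ n := by
    rw [h2s, ← Real.rpow_natCast]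
    exact Real.rpow_le_rpow_of_exponent_le (by norm_num) hn1
  have key := norm_le_pow_mul_add (φ := fun z => φ z ^ (N + 1)) (hφ.pow _)
    (B := M ^ (N + 1) * ‖φ 0‖ ^ (N + 1)) (δ := δ ^ (N + 1))
    (fun z hz => by
      rw [norm_pow, ← mul_pow]
      gcongr
      exact hB z hz) hE he hvol
    (fun t ht => by
      rw [norm_pow]
      gcongr
      exact hδ t ht) n
  rw [norm_pow] at key
  have h3 : M ^ (N + 1) * ‖φ 0‖ ^ (N + 1) / 2 ^ (n + 1) ≤ ‖φ 0‖ ^ (N + 1) / 2 := by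
    rw [div_le_div_iff₀ (by positivity) (by norm_num), pow_succ 2 n]
    have : 0 ≤ ‖φ 0‖ ^ (N + 1) := by positivity
    nlinarith
  have h4 : (12 / e) ^ (n + 1) ≤ (12 / e) ^ (2 : ℕ) * ((12 / e) ^ (log M / log 2)) ^ (N + 1) := by
    rw [← Real.rpow_natCast, ← Real.rpow_natCast, ← Real.rpow_natCast, ← Real.rpow_mul (by linarith),
      ← Real.rpow_add (by linarith)]
    refine Real.rpow_le_rpow_of_exponent_le hD ?_
    rw [mul_comm (log M / log 2), ← hs]
    push_cast
    linarith
  have h5 := mul_le_mul_of_nonneg_right h4 (pow_nonneg hδ0 (N + 1))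
  rw [mul_pow, ← mul_assoc]
  calc ‖φ 0‖ ^ (N + 1) ≤ 2 * ((12 / e) ^ (n + 1) * δ ^ (N + 1)) := by linarith
    _ ≤ _ := by
      refine (mul_le_mul_of_nonneg_left h5 two_pos.le).trans (le_of_eq ?_)
      ring

theorem exists_direction {d : ℕ} {α ℓ y : Fin d → ℝ} (hℓ : ∀ j, 0 < ℓ j) {E : Set (Fin d → ℝ)}
    (hE : MeasurableSet E) (hEQ : E ⊆ Set.univ.pi fun j => Set.Ico (α j) (α j + ℓ j))
    (hy : y ∈ Set.univ.pi fun j => Set.Ico (α j) (α j + ℓ j)) :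
    ∃ v : Fin d → ℝ, (∀ j, |v j| ≤ 2 * ℓ j) ∧
      volume E ≤ ENNReal.ofReal (2 * 4 ^ d * ∏ j, ℓ j) *
        volume {t : ℝ | t ∈ Set.Icc (0 : ℝ) 1 ∧ y + t • v ∈ E} := by
  set V : Set (Fin d → ℝ) := Set.univ.pi fun j => Set.Icc (-(2 * ℓ j)) (2 * ℓ j) with hV
  have hVm : MeasurableSet V := MeasurableSet.univ_pi fun _ => measurableSet_Icc
  have hVvol : volume V = ENNReal.ofReal (4 ^ d * ∏ j, ℓ j) := by
    have : (4 : ℝ) ^ d = ∏ _j : Fin d, 4 := by simp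
    rw [hV, volume_pi_pi, this, ← Finset.prod_mul_distrib,
      ENNReal.ofReal_prod_of_nonneg fun j _ => by have := hℓ j; positivity]
    exact Finset.prod_congr rfl fun j _ => by rw [Real.volume_Icc]; congr 1; ring
  have hprod : 0 < ∏ j, ℓ j := Finset.prod_pos fun j _ => hℓ j
  have hV0 : volume V ≠ 0 := by
    rw [hVvol]
    exact (ENNReal.ofReal_pos.2 (by positivity)).ne'
  set D : Set ((Fin d → ℝ) × ℝ) := (fun q => y + q.2 • q.1) ⁻¹' E with hD
  have hDm : MeasurableSet D := by
    refine hE.preimage ?_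
    have : Continuous fun q : (Fin d → ℝ) × ℝ => y + q.2 • q.1 := by fun_prop
    exact this.measurable
  set I : Set ℝ := Set.Icc (1 / 2) 1
  set g : (Fin d → ℝ) → ENNReal := fun v => ∫⁻ t in I, D.indicator 1 (v, t) with hg
  have hgI : ∀ v, g v = volume ({t | (v, t) ∈ D} ∩ I) := by
    intro v
    have hm : MeasurableSet {t : ℝ | (v, t) ∈ D} := hDm.preimage measurable_prodMk_left
    rw [hg, ← Measure.restrict_apply hm, ← lintegral_indicator_one hm]
    rfl
  have hint : volume E ≤ 2 * ∫⁻ v in V, g v := by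
    rw [hg, lintegral_lintegral_swap
      (f := fun v t => D.indicator 1 (v, t)) (by
        refine Measurable.aemeasurable ?_
        exact (measurable_one.indicator hDm))]
    have h1 : ∀ t ∈ I, volume E ≤ ∫⁻ v in V, D.indicator 1 (v, t) := by
      intro t ht
      have ht0 : 0 < t := lt_of_lt_of_le (by norm_num) ht.1
      have hm : MeasurableSet {v : Fin d → ℝ | (v, t) ∈ D} := hDm.preimage measurable_prodMk_right
      have h2 : ∫⁻ v in V, D.indicator (1 : (Fin d → ℝ) × ℝ → ENNReal) (v, t)
          = volume ({v : Fin d → ℝ | (v, t) ∈ D} ∩ V) := by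
        rw [← Measure.restrict_apply hm, ← lintegral_indicator_one hm]
        rfl
      have h3 : {v : Fin d → ℝ | (v, t) ∈ D} ∩ V = {v : Fin d → ℝ | (v, t) ∈ D} := by
        refine Set.inter_eq_left.2 fun v hv => ?_
        have hv' : y + t • v ∈ E := hv
        intro j _
        have h4 := hEQ hv' j trivial
        have h5 := hy j trivial
        simp only [Pi.add_apply, Pi.smul_apply, smul_eq_mul, Set.mem_Ico] at h4 h5
        have ht1 := ht.1
        constructor <;> by_contra! hc <;> nlinarith [hℓ j]
      have h4 : {v : Fin d → ℝ | (v, t) ∈ D} = (fun v => t • v) ⁻¹' ((fun v => y + v) ⁻¹' E) := rfl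
      rw [h2, h3, h4, Measure.addHaar_preimage_smul _ ht0.ne', measure_preimage_add]
      refine le_mul_of_one_le_left zero_le ?_
      rw [ENNReal.one_le_ofReal, abs_of_pos (by positivity)]
      exact (one_le_inv₀ (by positivity)).2 (pow_le_one₀ ht0.le ht.2)
    calc volume E = 2 * ∫⁻ _t in I, volume E := by
          rw [setLIntegral_const, Real.volume_Icc, mul_left_comm, ← ENNReal.ofReal_ofNat 2,
            ← ENNReal.ofReal_mul (by norm_num)]
          norm_num
      _ ≤ _ := by
          exact mul_le_mul_right (setLIntegral_mono' measurableSet_Icc h1) 2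
  have hgle : ∀ v, g v ≤ 1 := by
    intro v
    rw [hgI]
    refine (measure_mono Set.inter_subset_right).trans ?_
    rw [Real.volume_Icc]
    exact ENNReal.ofReal_le_one.2 (by norm_num)
  obtain ⟨v, hv, hvg⟩ := exists_setLAverage_le (f := g) hV0 hVm.nullMeasurableSet (by
    refine ne_top_of_le_ne_top ?_ (lintegral_mono hgle)
    rw [lintegral_one, Measure.restrict_apply_univ, hVvol]
    exact ENNReal.ofReal_ne_top)
  refine ⟨v, fun j => abs_le.2 (hv j trivial), ?_⟩
  rw [setLAverage_eq, ENNReal.div_le_iff hV0 (by rw [hVvol]; exact ENNReal.ofReal_ne_top), hgI,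
    hVvol] at hvg
  refine hint.trans ((mul_le_mul_right hvg 2).trans ?_)
  rw [mul_comm (volume _), ← mul_assoc, ← ENNReal.ofReal_ofNat 2, ← ENNReal.ofReal_mul (by norm_num),
    mul_assoc 2]
  gcongr
  rintro t ⟨ht, ht'⟩
  exact ⟨⟨(by norm_num : (0 : ℝ) ≤ 1 / 2).trans ht'.1, ht'.2⟩, ht⟩

theorem half_measure_le_measure_sublevel {X : Type*} [MeasurableSpace X] {μ : Measure X}
    [IsFiniteMeasure μ] {f : X → ENNReal} (hf : Measurable f) (hμ : μ Set.univ ≠ 0)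
    (hfin : ∫⁻ x, f x ∂μ ≠ ⊤) :
    μ Set.univ / 2 ≤ μ {x | f x ≤ 2 * (∫⁻ x, f x ∂μ) / μ Set.univ} := by
  set J := ∫⁻ x, f x ∂μ with hJ
  set A := {x | f x ≤ 2 * J / μ Set.univ} with hA
  have hAm : MeasurableSet A := measurableSet_le hf measurable_const
  have hcompl : μ Aᶜ ≤ μ Set.univ / 2 := by
    rcases eq_or_ne J 0 with h0 | h0
    · have h1 := (lintegral_eq_zero_iff hf).1 h0
      have h2 : μ Aᶜ = 0 := by
        refine measure_mono_null (fun x hx => ?_) (ae_iff.1 h1)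
        intro hx0
        simp only [Pi.zero_apply] at hx0
        exact hx (by simp [hA, hx0])
      rw [h2]
      exact zero_le
    · have hε0 : 2 * J / μ Set.univ ≠ 0 :=
        ENNReal.div_ne_zero.2 ⟨mul_ne_zero two_ne_zero h0, measure_ne_top _ _⟩
      have hεt : 2 * J / μ Set.univ ≠ ⊤ :=
        ENNReal.div_ne_top (ENNReal.mul_ne_top (by norm_num) hfin) hμ
      have h3 := meas_ge_le_lintegral_div (μ := μ) hf.aemeasurable hε0 hεt
      have h4 : μ Aᶜ ≤ μ {x | 2 * J / μ Set.univ ≤ f x} := measure_mono fun x hx => by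
        have hx' : ¬ f x ≤ 2 * J / μ Set.univ := hx
        exact (not_le.1 hx').le
      refine h4.trans (h3.trans (le_of_eq ?_))
      rw [← hJ, ENNReal.div_eq_inv_mul, ENNReal.inv_div (Or.inl (measure_ne_top _ _)) (Or.inl hμ),
        ENNReal.div_eq_inv_mul, ENNReal.mul_inv (Or.inl two_ne_zero) (Or.inl (by norm_num)),
        mul_right_comm, mul_assoc 2⁻¹, ENNReal.inv_mul_cancel h0 hfin, mul_one,
        ENNReal.div_eq_inv_mul]
  have hadd := measure_add_measure_compl hAm (μ := μ)
  have hhalf := ENNReal.add_halves (μ Set.univ)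
  have h4 : μ Set.univ / 2 + μ Set.univ / 2 ≤ μ A + μ Set.univ / 2 := by
    calc _ = μ Set.univ := hhalf
      _ = μ A + μ Aᶜ := hadd.symm
      _ ≤ _ := by gcongr
  exact (ENNReal.add_le_add_iff_right (ENNReal.div_ne_top (measure_ne_top _ _) two_ne_zero)).1 h4

theorem lintegral_tile_le {d : ℕ} {α ℓ : Fin d → ℝ} (hℓ : ∀ j, 0 < ℓ j) {Q : Set (Fin d → ℝ)}
    (hQ : Q = Set.univ.pi fun j => Set.Ico (α j) (α j + ℓ j)) {S : Set (Fin d → ℝ)}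
    (hS : MeasurableSet S) {γ : ℝ} (hγ : 0 < γ) (hγ1 : γ ≤ 1)
    (hvol : ENNReal.ofReal (γ * ∏ j, ℓ j) ≤ volume (S ∩ Q))
    {Φ : (Fin d → ℂ) → ℂ} (hΦ : Differentiable ℂ Φ) {G : (Fin d → ℝ) → ENNReal}
    (hG : Measurable G)
    (hΦG : ∀ (x : Fin d → ℝ) (w : Fin d → ℂ), (∀ j, ‖w j‖ ≤ 7 * ℓ j) →
      ‖Φ (fun j => (x j : ℂ) + w j)‖ₑ ≤ G x)
    {p : ℝ} (hp : 0 < p) {W : ℝ} (hW : 1 ≤ W)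
    (hfin : ∫⁻ x in Q, ‖Φ (fun j => (x j : ℂ))‖ₑ ^ p ≠ ⊤)
    (hgood : ∫⁻ x in Q, G x ^ p ≤
      ENNReal.ofReal W * ∫⁻ x in Q, ‖Φ (fun j => (x j : ℂ))‖ₑ ^ p) :
    ∫⁻ x in Q, ‖Φ (fun j => (x j : ℂ))‖ₑ ^ p ≤
      ENNReal.ofReal ((48 * 4 ^ d / γ) ^ (log W / log 2) * (2 / γ)) *
        ∫⁻ x in S ∩ Q, ‖Φ (fun j => (x j : ℂ))‖ₑ ^ p := by
  set g : (Fin d → ℝ) → ENNReal := fun x => ‖Φ (fun j => (x j : ℂ))‖ₑ ^ p with hg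
  have hgm : Measurable g := by
    have h1 : Continuous fun x : Fin d → ℝ => Φ (fun j => (x j : ℂ)) :=
      hΦ.continuous.comp (by fun_prop)
    exact h1.measurable.enorm.pow_const p
  have hprod : 0 < ∏ j, ℓ j := Finset.prod_pos fun j _ => hℓ j
  have hQm : MeasurableSet Q := hQ ▸ MeasurableSet.univ_pi fun _ => measurableSet_Ico
  have hQvol : volume Q = ENNReal.ofReal (∏ j, ℓ j) := by
    rw [hQ, volume_pi_pi, ENNReal.ofReal_prod_of_nonneg fun j _ => (hℓ j).le]
    exact Finset.prod_congr rfl fun j _ => by rw [Real.volume_Ico, add_sub_cancel_left]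
  have hQ0 : volume Q ≠ 0 := by
    rw [hQvol]
    exact (ENNReal.ofReal_pos.2 hprod).ne'
  have hQt : volume Q ≠ ⊤ := by
    rw [hQvol]
    exact ENNReal.ofReal_ne_top
  have hk0 : volume (S ∩ Q) ≠ 0 := ((ENNReal.ofReal_pos.2 (by positivity)).trans_le hvol).ne'
  have hkt : volume (S ∩ Q) ≠ ⊤ := ne_top_of_le_ne_top hQt (measure_mono Set.inter_subset_right)
  obtain ⟨y, hy, hyI⟩ := exists_setLAverage_le hQ0 hQm.nullMeasurableSet hfin
  obtain ⟨x, hx, hxI⟩ := exists_le_setLAverage hQ0 hQt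
    ((hG.pow_const p).aemeasurable.restrict (s := Q))
  rw [setLAverage_eq] at hyI hxI
  have hGx : G x ^ p ≤ ENNReal.ofReal W * g y :=
    calc G x ^ p ≤ (∫⁻ x in Q, G x ^ p) / volume Q := hxI
      _ ≤ (ENNReal.ofReal W * ∫⁻ x in Q, g x) / volume Q := by gcongr
      _ = ENNReal.ofReal W * ((∫⁻ x in Q, g x) / volume Q) := by rw [mul_div_assoc]
      _ ≤ _ := by gcongr
  -- points of `S ∩ Q` where `g` is controlled by its average
  set J := ∫⁻ x in S ∩ Q, g x with hJ
  have hJt : J ≠ ⊤ := ne_top_of_le_ne_top hfin (lintegral_mono_set Set.inter_subset_right)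
  have : IsFiniteMeasure (volume.restrict (S ∩ Q)) :=
    ⟨by rw [Measure.restrict_apply_univ]; exact hkt.lt_top⟩
  have hhalf := half_measure_le_measure_sublevel (μ := volume.restrict (S ∩ Q)) hgm
    (by rwa [Measure.restrict_apply_univ]) hJt
  rw [Measure.restrict_apply_univ] at hhalf
  set ε := 2 * J / volume (S ∩ Q) with hε
  have hεt : ε ≠ ⊤ := ENNReal.div_ne_top (ENNReal.mul_ne_top (by norm_num) hJt) hk0
  have hAm : MeasurableSet {x | g x ≤ ε} := measurableSet_le hgm measurable_const
  rw [Measure.restrict_apply hAm] at hhalf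
  have hEm := hAm.inter (hS.inter hQm)
  set E := {x | g x ≤ ε} ∩ (S ∩ Q) with hE
  obtain ⟨v, hv, hvE⟩ := exists_direction hℓ hEm
    (fun z hz => by rw [← hQ]; exact hz.2.2) (hQ ▸ hy)
  set φ : ℂ → ℂ := fun t => Φ (fun j => (y j : ℂ) + t * (v j : ℂ)) with hφ
  have hφd : Differentiable ℂ φ := by
    refine hΦ.comp ?_
    fun_prop
  have hφ0 : ‖φ 0‖ₑ ^ p = g y := by simp [hφ, hg]
  set M : ℝ := W ^ (1 / p) with hM
  have hM1 : 1 ≤ M := Real.one_le_rpow hW (by positivity)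
  have hMp : M ^ p = W := by
    rw [hM, ← Real.rpow_mul (by linarith), one_div_mul_cancel hp.ne', Real.rpow_one]
  have hgrowth : ∀ t : ℂ, ‖t‖ ≤ 3 → ‖φ t‖ ≤ M * ‖φ 0‖ := by
    intro t ht
    have h1 : ‖φ t‖ₑ ≤ G x := by
      have h2 : φ t = Φ (fun j => (x j : ℂ) + (((y j - x j : ℝ) : ℂ) + t * (v j : ℂ))) := by
        simp only [hφ]
        congr 1
        ext j
        push_cast
        ring
      rw [h2]
      refine hΦG x _ fun j => ?_
      have h3 : ‖((y j - x j : ℝ) : ℂ)‖ ≤ ℓ j := by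
        rw [Complex.norm_real, Real.norm_eq_abs, abs_le]
        rw [hQ] at hx hy
        have h4 := hx j trivial
        have h5 := hy j trivial
        simp only [Set.mem_Ico] at h4 h5
        constructor <;> linarith
      have h6 : ‖t * (v j : ℂ)‖ ≤ 3 * (2 * ℓ j) := by
        rw [norm_mul, Complex.norm_real, Real.norm_eq_abs]
        gcongr
        exact hv j
      linarith [norm_add_le ((y j - x j : ℝ) : ℂ) (t * (v j : ℂ))]
    have h7 : ‖φ t‖ₑ ^ p ≤ (ENNReal.ofReal M * ‖φ 0‖ₑ) ^ p := by
      rw [ENNReal.mul_rpow_of_nonneg _ _ hp.le, ENNReal.ofReal_rpow_of_pos (by linarith), hMp, hφ0]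
      exact (ENNReal.rpow_le_rpow h1 hp.le).trans hGx
    have h8 := (ENNReal.rpow_le_rpow_iff hp).1 h7
    rw [← ofReal_norm, ← ofReal_norm, ← ENNReal.ofReal_mul (by linarith)] at h8
    exact (ENNReal.ofReal_le_ofReal_iff (by positivity)).1 h8
  set e : ℝ := γ / (4 * 4 ^ d) with he
  have he0 : 0 < e := by positivity
  have he1 : e ≤ 1 := by
    rw [he, div_le_one (by positivity)]
    have : (1 : ℝ) ≤ 4 ^ d := one_le_pow₀ (by norm_num)
    linarith
  have hvolE : ENNReal.ofReal e ≤ volume {t : ℝ | t ∈ Set.Icc (0 : ℝ) 1 ∧ y + t • v ∈ E} := by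
    have h1 : ENNReal.ofReal (2 * 4 ^ d * ∏ j, ℓ j) * ENNReal.ofReal e ≤ volume E := by
      refine le_trans ?_ hhalf
      rw [← ENNReal.ofReal_mul (by positivity), ENNReal.le_div_iff_mul_le (by norm_num) (by norm_num)]
      refine le_trans (le_of_eq ?_) hvol
      rw [← ENNReal.ofReal_ofNat 2, ← ENNReal.ofReal_mul (by positivity), he]
      congr 1
      field_simp
      ring
    exact (ENNReal.mul_le_mul_iff_right (ENNReal.ofReal_pos.2 (by positivity)).ne'
      ENNReal.ofReal_ne_top).1 (h1.trans hvE)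
  set δ : ℝ := (ε ^ (1 / p)).toReal with hδ
  have hδt : ε ^ (1 / p) ≠ ⊤ := ENNReal.rpow_ne_top_of_nonneg (by positivity) hεt
  have hmain := norm_le_rpow_mul_of_growth hφd hM1 hgrowth (fun t ht => ht.1) he0 he1 hvolE
    (δ := δ) (by
      rintro t ⟨-, ht⟩
      have h1 : ‖φ t‖ₑ ^ p ≤ ε := by
        have h2 := ht.1
        simp only [hg, Set.mem_ofPred_eq] at h2
        simpa [hφ] using h2
      have h3 : ‖φ t‖ₑ ≤ ε ^ (1 / p) := by
        rw [one_div]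
        exact (ENNReal.le_rpow_inv_iff hp).2 h1
      rw [← toReal_enorm]
      exact ENNReal.toReal_mono hδt h3)
  have h12 : 12 / e = 48 * 4 ^ d / γ := by
    rw [he]
    field_simp
    ring
  set X : ℝ := (12 / e) ^ (log M / log 2) with hX
  have hX0 : 0 < X := by positivity
  have hXp : X ^ p = (48 * 4 ^ d / γ) ^ (log W / log 2) := by
    rw [hX, h12, ← Real.rpow_mul (by positivity), hM, Real.log_rpow (by linarith)]
    congr 1
    field_simp
  have hgy : g y ≤ ENNReal.ofReal (X ^ p) * ε := by
    have h1 : ‖φ 0‖ₑ ≤ ENNReal.ofReal X * ε ^ (1 / p) := by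
      rw [← ofReal_norm, ← ENNReal.ofReal_toReal hδt, ← ENNReal.ofReal_mul hX0.le]
      exact ENNReal.ofReal_le_ofReal hmain
    rw [← hφ0]
    refine (ENNReal.rpow_le_rpow h1 hp.le).trans (le_of_eq ?_)
    rw [ENNReal.mul_rpow_of_nonneg _ _ hp.le, ENNReal.ofReal_rpow_of_pos hX0, ← ENNReal.rpow_mul,
      one_div_mul_cancel hp.ne', ENNReal.rpow_one]
  rw [ENNReal.div_le_iff hQ0 hQt] at hyI
  refine hyI.trans ?_
  have hratio : 2 / volume (S ∩ Q) * volume Q ≤ ENNReal.ofReal (2 / γ) := by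
    rw [← ENNReal.mul_div_right_comm, ENNReal.div_le_iff hk0 hkt]
    refine le_trans (le_of_eq ?_) (mul_le_mul_right hvol _)
    rw [hQvol, ← ENNReal.ofReal_ofNat 2, ← ENNReal.ofReal_mul (by positivity),
      ← ENNReal.ofReal_mul (by positivity)]
    congr 1
    field_simp
  calc g y * volume Q ≤ ENNReal.ofReal (X ^ p) * ε * volume Q := by gcongr
    _ = ENNReal.ofReal (X ^ p) * (2 / volume (S ∩ Q) * volume Q) * J := by
      rw [hε, ENNReal.mul_div_right_comm]
      ring
    _ ≤ ENNReal.ofReal (X ^ p) * ENNReal.ofReal (2 / γ) * J := by gcongr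
    _ = _ := by rw [← ENNReal.ofReal_mul (by positivity), hXp]

open scoped Pointwise in
/-- Integrals of periodic functions over a period cube are translation invariant. -/
theorem setLIntegral_add_right_of_periodic {d : ℕ} {P : ℝ} (hP : 0 < P)
    {u : (Fin d → ℝ) → ENNReal}
    (hu : ∀ (n : Fin d → ℤ) (x : Fin d → ℝ), u (fun j => x j + n j * P) = u x) (s : Fin d → ℝ) :
    ∫⁻ x in Set.univ.pi fun _ => Set.Ico 0 P, u (x + s) =
      ∫⁻ x in Set.univ.pi fun _ => Set.Ico 0 P, u x := by
  set C : Set (Fin d → ℝ) := Set.univ.pi fun _ => Set.Ico 0 P with hC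
  set B : Module.Basis (Fin d) ℝ (Fin d → ℝ) :=
    (Pi.basisFun ℝ (Fin d)).isUnitSMul (w := fun _ => P) (fun _ => isUnit_iff_ne_zero.2 hP.ne')
    with hB
  have hBC : ZSpan.fundamentalDomain B = C := by
    ext x
    simp [ZSpan.mem_fundamentalDomain, hC, hB, Module.Basis.repr_isUnitSMul, Units.smul_def,
      Set.mem_pi, ← div_eq_inv_mul, le_div_iff₀ hP, div_lt_iff₀ hP]
  have hdom := ZSpan.isAddFundamentalDomain' B (volume : Measure (Fin d → ℝ))
  rw [hBC] at hdom
  have hdom' := hdom.vadd_of_comm s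
  have hper : ∀ (g : (Submodule.span ℤ (Set.range B)).toAddSubgroup) (x : Fin d → ℝ), u (g +ᵥ x) = u x := by
    intro g x
    have hg := (B.mem_span_iff_repr_mem ℤ (g : Fin d → ℝ)).1 g.2
    choose n hn using hg
    rw [← hu n x]
    congr 1
    ext j
    have h1 := hn j
    have h2 : (B.repr (g : Fin d → ℝ)) j = P⁻¹ * (g : Fin d → ℝ) j := by
      simp [hB, Module.Basis.repr_isUnitSMul, Units.smul_def]
    rw [h2] at h1
    have h3 : (g : Fin d → ℝ) j = n j * P := by
      simp only [algebraMap_int_eq, eq_intCast] at h1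
      rw [h1]
      field_simp
    rw [AddSubgroup.vadd_def, vadd_eq_add, Pi.add_apply, h3, add_comm]
  have h1 : ∫⁻ x in C, u (x + s) = ∫⁻ x in s +ᵥ C, u x := by
    have hmp : MeasurePreserving (fun x : Fin d → ℝ => x + s) volume volume :=
      measurePreserving_add_right volume s
    have he : MeasurableEmbedding (fun x : Fin d → ℝ => x + s) :=
      (MeasurableEquiv.addRight s).measurableEmbedding
    rw [← hmp.setLIntegral_comp_preimage_emb he u (s +ᵥ C)]
    congr 2
    ext x
    simp only [Set.mem_preimage, Set.mem_vadd_set_iff_neg_vadd_mem, vadd_eq_add]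
    rw [add_comm x s, neg_add_cancel_left]
  rw [h1]
  have : Countable (Submodule.span ℤ (Set.range B)).toAddSubgroup :=
    inferInstanceAs (Countable (Submodule.span ℤ (Set.range B)))
  exact hdom'.setLIntegral_eq hdom u hper

/-- Jensen's inequality for countable weighted sums. -/
theorem ENNReal.tsum_mul_rpow_le {ι : Type*} {p : ℝ} (hp : 1 ≤ p) (w f : ι → ENNReal) :
    (∑' i, w i * f i) ^ p ≤ (∑' i, w i) ^ (p - 1) * ∑' i, w i * f i ^ p := by
  have hp0 : 0 < p := by linarith
  have key : ∑' i, w i * f i ≤ (∑' i, w i) ^ (1 - p⁻¹) * (∑' i, w i * f i ^ p) ^ p⁻¹ := by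
    rw [ENNReal.tsum_eq_iSup_sum]
    refine iSup_le fun s => (ENNReal.inner_le_weight_mul_Lp_of_nonneg s hp w f).trans ?_
    have : 0 ≤ 1 - p⁻¹ := sub_nonneg.2 (inv_le_one_of_one_le₀ hp)
    gcongr <;> exact ENNReal.sum_le_tsum s
  refine (ENNReal.rpow_le_rpow key hp0.le).trans (le_of_eq ?_)
  rw [ENNReal.mul_rpow_of_nonneg _ _ hp0.le, ← ENNReal.rpow_mul, ← ENNReal.rpow_mul,
    inv_mul_cancel₀ hp0.ne', ENNReal.rpow_one, sub_mul, inv_mul_cancel₀ hp0.ne', one_mul]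

theorem lintegral_rpow_tsum_mul_le {X ι : Type*} [MeasurableSpace X] [Countable ι] {μ : Measure X}
    {p : ℝ} (hp : 1 ≤ p) (w : ι → ENNReal) {f : ι → X → ENNReal} (hf : ∀ i, Measurable (f i))
    {B I : ENNReal} (hw : ∑' i, w i ≤ B) (hI : ∀ i, ∫⁻ x, f i x ^ p ∂μ ≤ I) :
    ∫⁻ x, (∑' i, w i * f i x) ^ p ∂μ ≤ B ^ p * I := by
  have hp0 : 0 < p := by linarith
  calc ∫⁻ x, (∑' i, w i * f i x) ^ p ∂μ
      ≤ ∫⁻ x, (∑' i, w i) ^ (p - 1) * ∑' i, w i * f i x ^ p ∂μ :=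
        lintegral_mono fun x => ENNReal.tsum_mul_rpow_le hp w fun i => f i x
    _ = (∑' i, w i) ^ (p - 1) * ∑' i, w i * ∫⁻ x, f i x ^ p ∂μ := by
        have hm : ∀ i, Measurable fun x => f i x ^ p := fun i => (hf i).pow_const p
        rw [lintegral_const_mul _ (Measurable.tsum fun i => (hm i).const_mul _),
          lintegral_tsum fun i => ((hm i).const_mul _).aemeasurable]
        congr 1
        refine tsum_congr fun i => ?_
        rw [lintegral_const_mul _ (hm i)]
    _ ≤ B ^ (p - 1) * ∑' i, w i * I := by
        have : 0 ≤ p - 1 := by linarith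
        gcongr with i
        exact hI i
    _ ≤ B ^ (p - 1) * (B * I) := by
        rw [ENNReal.tsum_mul_right]
        gcongr
    _ = B ^ p * I := by
        rw [← mul_assoc]
        congr 1
        nth_rw 2 [← ENNReal.rpow_one B]
        rw [← ENNReal.rpow_add_of_nonneg _ _ (by linarith) zero_le_one, sub_add_cancel]

theorem hasSum_inv_sq_mul_exp {x : ℝ} (hx : x ∈ Set.Icc (0 : ℝ) 1) :
    HasSum (fun n : ℤ => 1 / (n : ℂ) ^ 2 * Complex.exp (2 * π * Complex.I * n * x))
      (2 * (π : ℂ) ^ 2 * ((x : ℂ) ^ 2 - x + 1 / 6)) := by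
  have h := hasSum_one_div_pow_mul_fourier_mul_bernoulliFun (k := 2) le_rfl hx
  rw [bernoulliFun_two] at h
  convert! h using 1
  · ext n
    rw [fourier_coe_apply]
    simp
  · rw [Nat.factorial_two, mul_pow, Complex.I_sq]
    push_cast
    ring

theorem hasSum_int_inv_sq : HasSum (fun n : ℤ => 1 / (n : ℝ) ^ 2) (π ^ 2 / 3) := by
  have h := hasSum_inv_sq_mul_exp (x := 0) (by simp)
  rw [← Complex.hasSum_ofReal]
  convert! h using 1
  · ext n
    simp
  · push_cast
    ring

/-- On the band `[-σ, σ]` the identity is an absolutely convergent series of exponentials. -/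
theorem exists_hasSum_exp_eq_self {σ : ℝ} (hσ : 0 < σ) :
    ∃ (c : ℤ → ℂ) (s : ℤ → ℝ), ∑' n, ‖c n‖ₑ ≤ ENNReal.ofReal (4 * σ / 3) ∧
      ∀ μ : ℝ, |μ| ≤ σ → HasSum (fun n => c n * Complex.exp (Complex.I * (μ * s n))) μ := by
  refine ⟨fun n => 2 * σ / π ^ 2 * ((Complex.exp (π * Complex.I * n) - 1) *
    (1 / (n : ℂ) ^ 2 * Complex.exp (π / 2 * Complex.I * n))), fun n => π * n / (2 * σ), ?_, ?_⟩
  · have h1 : ∀ n : ℤ, ‖2 * σ / π ^ 2 * ((Complex.exp (π * Complex.I * n) - 1) *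
        (1 / (n : ℂ) ^ 2 * Complex.exp (π / 2 * Complex.I * n)))‖ₑ ≤
          ENNReal.ofReal (4 * σ / π ^ 2 * (1 / (n : ℝ) ^ 2)) := by
      intro n
      rw [← ofReal_norm]
      refine ENNReal.ofReal_le_ofReal ?_
      have e1 : ‖Complex.exp (π * Complex.I * n)‖ = 1 := by
        rw [show (π * Complex.I * n : ℂ) = ((π * n : ℝ) : ℂ) * Complex.I by push_cast; ring]
        exact Complex.norm_exp_ofReal_mul_I _
      have e2 : ‖Complex.exp (π / 2 * Complex.I * n)‖ = 1 := by
        rw [show (π / 2 * Complex.I * n : ℂ) = ((π / 2 * n : ℝ) : ℂ) * Complex.I by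
          push_cast; ring]
        exact Complex.norm_exp_ofReal_mul_I _
      have e3 : ‖Complex.exp (π * Complex.I * n) - 1‖ ≤ 2 := by
        refine (norm_sub_le _ _).trans ?_
        rw [e1, norm_one]
        norm_num
      have e4 : ‖(2 * σ / π ^ 2 : ℂ)‖ = 2 * σ / π ^ 2 := by
        rw [show (2 * σ / π ^ 2 : ℂ) = ((2 * σ / π ^ 2 : ℝ) : ℂ) by push_cast; ring,
          Complex.norm_real, Real.norm_of_nonneg (by positivity)]
      have e5 : ‖(1 / (n : ℂ) ^ 2)‖ = 1 / (n : ℝ) ^ 2 := by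
        rw [show (1 / (n : ℂ) ^ 2) = ((1 / (n : ℝ) ^ 2 : ℝ) : ℂ) by push_cast; ring,
          Complex.norm_real, Real.norm_of_nonneg (by positivity)]
      rw [norm_mul, norm_mul, norm_mul, e2, e4, e5, mul_one]
      calc 2 * σ / π ^ 2 * (‖Complex.exp (π * Complex.I * n) - 1‖ * (1 / (n : ℝ) ^ 2))
          ≤ 2 * σ / π ^ 2 * (2 * (1 / (n : ℝ) ^ 2)) := by gcongr
        _ = _ := by ring
    refine (ENNReal.tsum_le_tsum h1).trans (le_of_eq ?_)
    have h2 := hasSum_int_inv_sq.mul_left (4 * σ / π ^ 2)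
    rw [← ENNReal.ofReal_tsum_of_nonneg (fun n => by positivity) h2.summable, h2.tsum_eq]
    congr 1
    field_simp
  · intro μ hμ
    obtain ⟨h1, h2⟩ := abs_le.1 hμ
    have h3 : |μ / (4 * σ)| ≤ 1 / 4 := by
      rw [abs_div, abs_of_pos (by positivity : 0 < 4 * σ), div_le_div_iff₀ (by positivity) (by norm_num)]
      linarith
    obtain ⟨h4, h5⟩ := abs_le.1 h3
    have hx := hasSum_inv_sq_mul_exp (x := 1 / 4 + μ / (4 * σ)) ⟨by linarith, by linarith⟩
    have hx' := hasSum_inv_sq_mul_exp (x := 1 / 4 + μ / (4 * σ) + 1 / 2) ⟨by linarith, by linarith⟩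
    have hσ' : (σ : ℂ) ≠ 0 := by exact_mod_cast hσ.ne'
    have hπ' : (π : ℂ) ≠ 0 := by exact_mod_cast pi_ne_zero
    convert! (hx'.sub hx).mul_left (2 * σ / π ^ 2 : ℂ) using 1
    · ext n
      have e1 : Complex.exp (2 * π * Complex.I * n * ((1 / 4 + μ / (4 * σ) + 1 / 2 : ℝ) : ℂ)) =
          Complex.exp (π * Complex.I * n) * (Complex.exp (π / 2 * Complex.I * n) *
            Complex.exp (Complex.I * (μ * ((π * n / (2 * σ) : ℝ) : ℂ)))) := by
        rw [← Complex.exp_add, ← Complex.exp_add]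
        congr 1
        push_cast
        field_simp
        ring
      have e2 : Complex.exp (2 * π * Complex.I * n * ((1 / 4 + μ / (4 * σ) : ℝ) : ℂ)) =
          Complex.exp (π / 2 * Complex.I * n) *
            Complex.exp (Complex.I * (μ * ((π * n / (2 * σ) : ℝ) : ℂ))) := by
        rw [← Complex.exp_add]
        congr 1
        push_cast
        field_simp
        ring
      rw [e1, e2]
      ring
    · push_cast
      field_simp
      ring

/-- The exponential sum with frequencies `μ k` and coefficients `F k`, as an entire function. -/
noncomputable def expSum {ι : Type*} {d : ℕ} (T : Finset ι) (μ : ι → Fin d → ℝ) (F : ι → ℂ)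
    (z : Fin d → ℂ) : ℂ :=
  ∑ k ∈ T, F k * Complex.exp (Complex.I * ∑ j, (μ k j : ℂ) * z j)

theorem differentiable_expSum {ι : Type*} {d : ℕ} (T : Finset ι) (μ : ι → Fin d → ℝ) (F : ι → ℂ) :
    Differentiable ℂ (expSum T μ F) := by
  unfold expSum
  fun_prop

/-- A weighted superposition of translates of `u`. -/
noncomputable def shiftAvg {κ : Type*} {d : ℕ} (w : κ → ENNReal) (τ : κ → Fin d → ℝ)
    (u : (Fin d → ℝ) → ENNReal) (x : Fin d → ℝ) : ENNReal :=
  ∑' i, w i * u (x + τ i)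

theorem shiftAvg_mono {κ : Type*} {d : ℕ} (w : κ → ENNReal) (τ : κ → Fin d → ℝ) :
    Monotone (shiftAvg w τ) := by
  intro u v huv x
  exact ENNReal.tsum_le_tsum fun i => by gcongr; exact huv _

theorem measurable_shiftAvg {κ : Type*} [Countable κ] {d : ℕ} (w : κ → ENNReal)
    (τ : κ → Fin d → ℝ) {u : (Fin d → ℝ) → ENNReal} (hu : Measurable u) :
    Measurable (shiftAvg w τ u) :=
  Measurable.tsum fun i => (hu.comp (measurable_add_const (τ i))).const_mul (w i)

theorem measurable_iterate_shiftAvg {κ : Type*} [Countable κ] {d : ℕ} (w : κ → ENNReal)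
    (τ : κ → Fin d → ℝ) {u : (Fin d → ℝ) → ENNReal} (hu : Measurable u) (m : ℕ) :
    Measurable ((shiftAvg w τ)^[m] u) := by
  induction m with
  | zero => exact hu
  | succ m ih =>
    rw [Function.iterate_succ_apply']
    exact measurable_shiftAvg w τ ih

theorem iterate_shiftAvg_periodic {κ : Type*} {d : ℕ} (w : κ → ENNReal)
    (τ : κ → Fin d → ℝ) {P : ℝ} {u : (Fin d → ℝ) → ENNReal}
    (hu : ∀ (n : Fin d → ℤ) (x : Fin d → ℝ), u (fun j => x j + n j * P) = u x) (m : ℕ)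
    (n : Fin d → ℤ) (x : Fin d → ℝ) :
    (shiftAvg w τ)^[m] u (fun j => x j + n j * P) = (shiftAvg w τ)^[m] u x := by
  induction m generalizing x with
  | zero => exact hu n x
  | succ m ih =>
    rw [Function.iterate_succ_apply']
    refine tsum_congr fun i => ?_
    have h1 : (fun j => x j + n j * P) + τ i = fun j => (x + τ i) j + n j * P := by
      ext j
      simp only [Pi.add_apply]
      ring
    rw [h1, ih]

theorem setLIntegral_iterate_shiftAvg_rpow_le {κ : Type*} [Countable κ] {d : ℕ}
    {w : κ → ENNReal} (τ : κ → Fin d → ℝ) {P : ℝ} (hP : 0 < P) {u : (Fin d → ℝ) → ENNReal}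
    (hum : Measurable u)
    (hu : ∀ (n : Fin d → ℤ) (x : Fin d → ℝ), u (fun j => x j + n j * P) = u x) {p : ℝ}
    (hp : 1 ≤ p) {B : ENNReal} (hw : ∑' i, w i ≤ B) (m : ℕ) :
    ∫⁻ x in Set.univ.pi fun _ => Set.Ico 0 P, (shiftAvg w τ)^[m] u x ^ p ≤
      (B ^ m) ^ p * ∫⁻ x in Set.univ.pi fun _ => Set.Ico 0 P, u x ^ p := by
  induction m with
  | zero => simp
  | succ m ih =>
    rw [Function.iterate_succ_apply', pow_succ', ENNReal.mul_rpow_of_nonneg _ _ (by linarith),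
      mul_assoc]
    refine lintegral_rpow_tsum_mul_le hp w
      (fun i => (measurable_iterate_shiftAvg w τ hum m).comp (measurable_add_const (τ i))) hw
      fun i => ?_
    refine le_trans (le_of_eq ?_) ih
    exact setLIntegral_add_right_of_periodic (u := fun x => (shiftAvg w τ)^[m] u x ^ p) hP
      (fun n x => by rw [iterate_shiftAvg_periodic w τ hu]) (τ i)

/-- Bernstein's inequality in pointwise form. -/
theorem enorm_expSum_deriv_le_shiftAvg {ι : Type*} {d : ℕ} {T : Finset ι} {μ : ι → Fin d → ℝ}
    {σ : Fin d → ℝ} (hμ : ∀ k ∈ T, ∀ j, |μ k j| ≤ σ j) {c : Fin d → ℤ → ℂ}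
    {s : Fin d → ℤ → ℝ} (hc : ∀ j, ∀ t : ℝ, |t| ≤ σ j →
      HasSum (fun n => c j n * Complex.exp (Complex.I * (t * s j n))) t)
    {ρ : Fin d → ℝ} {w : Fin d → ℂ} (hw : ∀ j, ‖w j‖ ≤ ρ j) (F : ι → ℂ) (x : Fin d → ℝ) :
    ‖expSum T μ (fun k => F k * (Complex.I * ∑ j, (μ k j : ℂ) * w j)) (fun j => (x j : ℂ))‖ₑ ≤
      shiftAvg (fun i : Fin d × ℤ => ENNReal.ofReal (ρ i.1) * ‖c i.1 i.2‖ₑ)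
        (fun i => Pi.single i.1 (s i.1 i.2)) (fun y => ‖expSum T μ F (fun j => (y j : ℂ))‖ₑ) x := by
  have key : ∀ j, HasSum (fun n => c j n * expSum T μ F
      (fun l => ((x + Pi.single j (s j n) : Fin d → ℝ) l : ℂ)))
      (∑ k ∈ T, F k * μ k j * Complex.exp (Complex.I * ∑ l, (μ k l : ℂ) * x l)) := by
    intro j
    have h1 : HasSum (fun n => ∑ k ∈ T,
        (F k * Complex.exp (Complex.I * ∑ l, (μ k l : ℂ) * x l)) *
          (c j n * Complex.exp (Complex.I * (μ k j * s j n))))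
        (∑ k ∈ T, (F k * Complex.exp (Complex.I * ∑ l, (μ k l : ℂ) * x l)) * μ k j) :=
      hasSum_sum fun k hk => (hc j _ (hμ k hk j)).mul_left _
    convert! h1 using 1
    · ext n
      rw [expSum, Finset.mul_sum]
      refine Finset.sum_congr rfl fun k _ => ?_
      have e1 : ∑ l, (μ k l : ℂ) * ((x + Pi.single j (s j n) : Fin d → ℝ) l : ℂ) =
          ∑ l, (μ k l : ℂ) * x l + μ k j * s j n := by
        simp only [Pi.add_apply, Complex.ofReal_add, mul_add, Finset.sum_add_distrib]
        congr 1
        rw [Finset.sum_eq_single j] <;> simp +contextual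
      rw [e1, mul_add, Complex.exp_add]
      ring
    · exact Finset.sum_congr rfl fun k _ => by ring
  have hsum : expSum T μ (fun k => F k * (Complex.I * ∑ j, (μ k j : ℂ) * w j))
      (fun j => (x j : ℂ)) = ∑ j, Complex.I * w j *
        ∑' n, c j n * expSum T μ F (fun l => ((x + Pi.single j (s j n) : Fin d → ℝ) l : ℂ)) := by
    rw [Finset.sum_congr rfl fun j _ => by rw [(key j).tsum_eq, Finset.mul_sum], Finset.sum_comm,
      expSum]
    refine Finset.sum_congr rfl fun k _ => ?_
    rw [Finset.mul_sum, Finset.mul_sum, Finset.sum_mul]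
    exact Finset.sum_congr rfl fun j _ => by ring
  rw [hsum, shiftAvg, ENNReal.tsum_prod', tsum_fintype]
  refine (enorm_sum_le _ _).trans (Finset.sum_le_sum fun j _ => ?_)
  rw [enorm_mul, enorm_mul, ← ofReal_norm Complex.I, Complex.norm_I, ENNReal.ofReal_one, one_mul]
  simp only [mul_assoc]
  rw [ENNReal.tsum_mul_left]
  gcongr
  · rw [← ofReal_norm]
    exact ENNReal.ofReal_le_ofReal (hw j)
  · refine enorm_tsum_le_tsum_enorm.trans (ENNReal.tsum_le_tsum fun n => ?_)
    rw [enorm_mul]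

/-- A majorant of an exponential sum on complex polydiscs, with controlled `L^p` norm. -/
theorem exists_growth_majorant {ι : Type*} {d : ℕ} {T : Finset ι} {μ : ι → Fin d → ℝ}
    {F : ι → ℂ} {σ ρ : Fin d → ℝ} (hσ : ∀ j, 0 < σ j) (hρ : ∀ j, 0 ≤ ρ j)
    (hμ : ∀ k ∈ T, ∀ j, |μ k j| ≤ σ j) {P : ℝ} (hP : 0 < P)
    (hper : ∀ (n : Fin d → ℤ) (x : Fin d → ℝ),
      ‖expSum T μ F (fun j => ((x j + n j * P : ℝ) : ℂ))‖ₑ = ‖expSum T μ F (fun j => (x j : ℂ))‖ₑ)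
    (hpos : 0 < ∑ j, ρ j * (4 * σ j / 3)) {p : ℝ} (hp : 1 ≤ p) :
    ∃ G : (Fin d → ℝ) → ENNReal, Measurable G ∧
      (∀ (x : Fin d → ℝ) (w : Fin d → ℂ), (∀ j, ‖w j‖ ≤ ρ j) →
        ‖expSum T μ F (fun j => (x j : ℂ) + w j)‖ₑ ≤ G x) ∧
      ∫⁻ x in Set.univ.pi fun _ => Set.Ico 0 P, G x ^ p ≤
        ENNReal.ofReal (Real.exp (p * ∑ j, ρ j * (4 * σ j / 3))) *
          ∫⁻ x in Set.univ.pi fun _ => Set.Ico 0 P, ‖expSum T μ F (fun j => (x j : ℂ))‖ₑ ^ p := by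
  choose c s hcn hc using fun j => exists_hasSum_exp_eq_self (hσ j)
  set w₀ : Fin d × ℤ → ENNReal := fun i => ENNReal.ofReal (ρ i.1) * ‖c i.1 i.2‖ₑ with hw₀
  set τ : Fin d × ℤ → Fin d → ℝ := fun i => Pi.single i.1 (s i.1 i.2) with hτ
  set u : (Fin d → ℝ) → ENNReal := fun x => ‖expSum T μ F (fun j => (x j : ℂ))‖ₑ with hu
  set A : ℝ := ∑ j, ρ j * (4 * σ j / 3) with hA
  have hum : Measurable u := by
    have h1 : Continuous fun x : Fin d → ℝ => expSum T μ F (fun j => (x j : ℂ)) :=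
      (differentiable_expSum T μ F).continuous.comp (by fun_prop)
    exact h1.measurable.enorm
  have hwA : ∑' i, w₀ i ≤ ENNReal.ofReal A := by
    rw [ENNReal.tsum_prod', tsum_fintype, hA, ENNReal.ofReal_sum_of_nonneg fun j _ =>
      mul_nonneg (hρ j) (by have := hσ j; positivity)]
    refine Finset.sum_le_sum fun j _ => ?_
    simp only [hw₀]
    rw [ENNReal.tsum_mul_left, ENNReal.ofReal_mul (hρ j)]
    gcongr
    exact hcn j
  refine ⟨fun x => ∑' m : ℕ, ENNReal.ofReal (m.factorial : ℝ)⁻¹ * (shiftAvg w₀ τ)^[m] u x,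
    Measurable.tsum fun m => (measurable_iterate_shiftAvg w₀ τ hum m).const_mul _, ?_, ?_⟩
  · intro x w hw
    have hiter : ∀ (m : ℕ) (y : Fin d → ℝ),
        ‖expSum T μ (fun k => F k * (Complex.I * ∑ j, (μ k j : ℂ) * w j) ^ m)
          (fun j => (y j : ℂ))‖ₑ ≤ (shiftAvg w₀ τ)^[m] u y := by
      intro m
      induction m with
      | zero => intro y; simp [hu]
      | succ m ih =>
        intro y
        rw [Function.iterate_succ_apply']
        have h1 := enorm_expSum_deriv_le_shiftAvg hμ hc hw
          (fun k => F k * (Complex.I * ∑ j, (μ k j : ℂ) * w j) ^ m) y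
        simp only [mul_assoc, ← pow_succ] at h1 ⊢
        exact h1.trans (shiftAvg_mono w₀ τ ih y)
    have hexp : HasSum (fun m : ℕ => ((m.factorial : ℂ)⁻¹) *
        expSum T μ (fun k => F k * (Complex.I * ∑ j, (μ k j : ℂ) * w j) ^ m)
          (fun j => (x j : ℂ))) (expSum T μ F (fun j => (x j : ℂ) + w j)) := by
      have h1 : HasSum (fun m : ℕ => ∑ k ∈ T,
          F k * Complex.exp (Complex.I * ∑ j, (μ k j : ℂ) * x j) *
            ((Complex.I * ∑ j, (μ k j : ℂ) * w j) ^ m / (m.factorial : ℂ)))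
          (∑ k ∈ T, F k * Complex.exp (Complex.I * ∑ j, (μ k j : ℂ) * x j) *
            Complex.exp (Complex.I * ∑ j, (μ k j : ℂ) * w j)) := by
        refine hasSum_sum fun k _ => HasSum.mul_left _ ?_
        have h2 := NormedSpace.expSeries_div_hasSum_exp (𝔸 := ℂ)
          (Complex.I * ∑ j, (μ k j : ℂ) * w j)
        rwa [← Complex.exp_eq_exp_ℂ] at h2
      convert! h1 using 1
      · ext m
        rw [expSum, Finset.mul_sum]
        exact Finset.sum_congr rfl fun k _ => by ring
      · rw [expSum]
        refine Finset.sum_congr rfl fun k _ => ?_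
        rw [mul_assoc, ← Complex.exp_add]
        simp only [mul_add, Finset.sum_add_distrib]
    rw [← hexp.tsum_eq]
    refine enorm_tsum_le_tsum_enorm.trans (ENNReal.tsum_le_tsum fun m => ?_)
    rw [enorm_mul]
    gcongr
    · rw [← ofReal_norm, norm_inv, Complex.norm_natCast]
    · exact hiter m x
  · have hp0 : 0 < p := by linarith
    set B : ENNReal := ENNReal.ofReal A with hB
    have hB0 : ∀ m : ℕ, B ^ m ≠ 0 := fun m => pow_ne_zero m (ENNReal.ofReal_pos.2 hpos).ne'
    have hBt : ∀ m : ℕ, B ^ m ≠ ⊤ := fun m => ENNReal.pow_ne_top ENNReal.ofReal_ne_top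
    have hsumw : ∑' m : ℕ, ENNReal.ofReal (m.factorial : ℝ)⁻¹ * B ^ m ≤
        ENNReal.ofReal (Real.exp A) := by
      have h1 := NormedSpace.expSeries_div_hasSum_exp (𝔸 := ℝ) A
      rw [← Real.exp_eq_exp_ℝ] at h1
      rw [← h1.tsum_eq, ENNReal.ofReal_tsum_of_nonneg (fun m => by positivity) h1.summable]
      refine ENNReal.tsum_le_tsum fun m => le_of_eq ?_
      rw [hB, ← ENNReal.ofReal_pow hpos.le, ← ENNReal.ofReal_mul (by positivity), div_eq_inv_mul]
    have h1 := lintegral_rpow_tsum_mul_le (μ := volume.restrict (Set.univ.pi fun _ => Set.Ico 0 P))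
      hp (fun m : ℕ => ENNReal.ofReal (m.factorial : ℝ)⁻¹ * B ^ m)
      (f := fun m x => (B ^ m)⁻¹ * (shiftAvg w₀ τ)^[m] u x)
      (I := ∫⁻ x in Set.univ.pi fun _ => Set.Ico 0 P, u x ^ p)
      (fun m => (measurable_iterate_shiftAvg w₀ τ hum m).const_mul _) hsumw fun m => by
        simp only [ENNReal.mul_rpow_of_nonneg _ _ hp0.le]
        rw [lintegral_const_mul _ ((measurable_iterate_shiftAvg w₀ τ hum m).pow_const p)]
        refine (mul_le_mul_right
          (setLIntegral_iterate_shiftAvg_rpow_le τ hP hum hper hp hwA m) _).trans (le_of_eq ?_)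
        rw [← mul_assoc, ← ENNReal.mul_rpow_of_nonneg _ _ hp0.le,
          ENNReal.inv_mul_cancel (hB0 m) (hBt m), ENNReal.one_rpow, one_mul]
    rw [ENNReal.ofReal_rpow_of_pos (Real.exp_pos A), ← Real.exp_mul, mul_comm A p] at h1
    refine le_trans (le_of_eq ?_) h1
    refine lintegral_congr fun x => ?_
    congr 1
    refine tsum_congr fun m => ?_
    rw [mul_assoc, ← mul_assoc (B ^ m), ENNReal.mul_inv_cancel (hB0 m) (hBt m), one_mul]

theorem setLIntegral_cube_eq_sum {d : ℕ} {N : Fin d → ℕ} {ℓ : Fin d → ℝ} (hℓ : ∀ j, 0 < ℓ j)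
    {P : ℝ} (hN : ∀ j, N j * ℓ j = P) (ν : Measure (Fin d → ℝ)) (f : (Fin d → ℝ) → ENNReal) :
    ∫⁻ x in Set.univ.pi fun _ => Set.Ico 0 P, f x ∂ν =
      ∑ q ∈ Fintype.piFinset fun j => Finset.range (N j),
        ∫⁻ x in Set.univ.pi fun j => Set.Ico (q j * ℓ j) (q j * ℓ j + ℓ j), f x ∂ν := by
  rw [← lintegral_biUnion_finset _ fun q _ => MeasurableSet.univ_pi fun _ => measurableSet_Ico]
  · congr 2
    ext x
    simp only [Set.mem_pi, Set.mem_univ, true_implies, Set.mem_Ico, Set.mem_iUnion,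
      Fintype.mem_piFinset, Finset.mem_range, exists_prop]
    constructor
    · intro hx
      refine ⟨fun j => ⌊x j / ℓ j⌋₊, fun j => ?_, fun j => ?_⟩
      · have h0 : 0 ≤ x j / ℓ j := div_nonneg (hx j).1 (hℓ j).le
        rw [Nat.floor_lt h0, div_lt_iff₀ (hℓ j), hN]
        exact (hx j).2
      · have h0 : 0 ≤ x j / ℓ j := div_nonneg (hx j).1 (hℓ j).le
        have h1 := Nat.floor_le h0
        have h2 := Nat.lt_floor_add_one (x j / ℓ j)
        rw [le_div_iff₀ (hℓ j)] at h1
        rw [div_lt_iff₀ (hℓ j), add_mul, one_mul] at h2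
        exact ⟨h1, h2⟩
    · rintro ⟨q, hq, hx⟩ j
      have h1 : ((q j : ℝ) + 1) * ℓ j ≤ N j * ℓ j :=
        mul_le_mul_of_nonneg_right (by exact_mod_cast hq j) (hℓ j).le
      rw [hN, add_mul, one_mul] at h1
      exact ⟨(mul_nonneg (Nat.cast_nonneg _) (hℓ j).le).trans (hx j).1, (hx j).2.trans_le h1⟩
  · intro q _ q' _ hqq
    rw [Function.onFun, Set.disjoint_left]
    intro x hx hx'
    refine hqq (funext fun j => ?_)
    have key : ∀ m n : ℕ, m * ℓ j ≤ x j → x j < n * ℓ j + ℓ j → m ≤ n := by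
      intro m n h1 h2
      have h3 : (m : ℝ) * ℓ j < ((n : ℝ) + 1) * ℓ j := by linarith
      have h4 := lt_of_mul_lt_mul_right h3 (hℓ j).le
      exact Nat.lt_succ_iff.1 (by exact_mod_cast h4)
    have h1 := hx j trivial
    have h2 := hx' j trivial
    exact le_antisymm (key _ _ h1.1 h2.2) (key _ _ h2.1 h1.2)

theorem exists_nat_mul_eq_of_le {a P : ℝ} (ha : 0 < a) (haP : a ≤ P) :
    ∃ (N : ℕ) (ℓ : ℝ), N * ℓ = P ∧ a ≤ ℓ ∧ ℓ ≤ 2 * a := by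
  have h1 : 1 ≤ P / a := (one_le_div ha).2 haP
  have hN : 1 ≤ ⌊P / a⌋₊ := (Nat.one_le_floor_iff _).2 h1
  have hN' : (1 : ℝ) ≤ ⌊P / a⌋₊ := by exact_mod_cast hN
  have h2 := Nat.floor_le (zero_le_one.trans h1)
  have h3 := Nat.lt_floor_add_one (P / a)
  rw [le_div_iff₀ ha] at h2
  rw [div_lt_iff₀ ha] at h3
  refine ⟨⌊P / a⌋₊, P / ⌊P / a⌋₊, by field_simp, ?_, ?_⟩
  · rw [le_div_iff₀ (by linarith)]
    linarith
  · rw [div_le_iff₀ (by linarith)]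
    nlinarith

theorem ofReal_le_measure_inter_tile {d : ℕ} {a ℓ : Fin d → ℝ} (ha : ∀ j, 0 < a j)
    (haℓ : ∀ j, a j ≤ ℓ j) (hℓa : ∀ j, ℓ j ≤ 2 * a j) {γ : ℝ} (hγ : 0 < γ)
    {S : Set (Fin d → ℝ)} (hthick : ∀ x : Fin d → ℝ,
      volume (S ∩ Set.univ.pi fun i => Set.Icc (x i) (x i + a i)) ≥ ENNReal.ofReal (γ * ∏ i, a i))
    (x : Fin d → ℝ) :
    ENNReal.ofReal (γ / 2 ^ d * ∏ j, ℓ j) ≤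
      volume (S ∩ Set.univ.pi fun j => Set.Ico (x j) (x j + ℓ j)) := by
  have h1 : ∏ j, ℓ j ≤ 2 ^ d * ∏ j, a j := by
    have h2 := Finset.prod_le_prod (s := Finset.univ)
      (fun j _ => ((ha j).le.trans (haℓ j))) (fun j _ => hℓa j)
    rwa [Finset.prod_mul_distrib, Finset.prod_const, Finset.card_univ, Fintype.card_fin] at h2
  have h3 : γ / 2 ^ d * ∏ j, ℓ j ≤ γ * ∏ j, a j := by
    calc γ / 2 ^ d * ∏ j, ℓ j ≤ γ / 2 ^ d * (2 ^ d * ∏ j, a j) := by gcongr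
      _ = γ * ∏ j, a j := by field_simp
  refine (ENNReal.ofReal_le_ofReal h3).trans ((hthick x).le.trans ?_)
  have h4 : (Set.univ.pi fun j => Set.Ico (x j) (x j + a j)) =ᵐ[volume]
      (Set.univ.pi fun j => Set.Icc (x j) (x j + a j) : Set (Fin d → ℝ)) := by
    have := Measure.univ_pi_Ico_ae_eq_Icc (μ := fun _ : Fin d => (volume : Measure ℝ)) (f := x)
      (g := fun j => x j + a j)
    rwa [← Set.pi_univ_Icc] at this
  rw [← measure_congr ((Filter.EventuallyEq.refl _ S).inter h4)]
  refine measure_mono (Set.inter_subset_inter_right S (Set.pi_mono fun j _ => ?_))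
  exact Set.Ico_subset_Ico_right (by linarith [haℓ j])

theorem setLIntegral_cube_le {d : ℕ} {P : ℝ} {a : Fin d → ℝ} (ha : ∀ j, 0 < a j)
    (haP : ∀ j, a j ≤ P) {γ : ℝ} (hγ : 0 < γ) (hγ1 : γ ≤ 1)
    {S : Set (Fin d → ℝ)} (hS : MeasurableSet S) (hthick : ∀ x : Fin d → ℝ,
      volume (S ∩ Set.univ.pi fun i => Set.Icc (x i) (x i + a i)) ≥ ENNReal.ofReal (γ * ∏ i, a i))
    {Φ : (Fin d → ℂ) → ℂ} (hΦ : Differentiable ℂ Φ) {G : (Fin d → ℝ) → ENNReal}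
    (hG : Measurable G)
    (hΦG : ∀ (x : Fin d → ℝ) (w : Fin d → ℂ), (∀ j, ‖w j‖ ≤ 14 * a j) →
      ‖Φ (fun j => (x j : ℂ) + w j)‖ₑ ≤ G x)
    {p : ℝ} (hp : 0 < p) {V : ℝ} (hV : 1 ≤ V)
    (hfin : ∫⁻ x in Set.univ.pi fun _ => Set.Ico 0 P, ‖Φ (fun j => (x j : ℂ))‖ₑ ^ p ≠ ⊤)
    (hGint : ∫⁻ x in Set.univ.pi fun _ => Set.Ico 0 P, G x ^ p ≤
      ENNReal.ofReal V *
        ∫⁻ x in Set.univ.pi fun _ => Set.Ico 0 P, ‖Φ (fun j => (x j : ℂ))‖ₑ ^ p) :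
    ∫⁻ x in Set.univ.pi fun _ => Set.Ico 0 P, ‖Φ (fun j => (x j : ℂ))‖ₑ ^ p ≤
      ENNReal.ofReal (2 * ((48 * 8 ^ d / γ) ^ (log (2 * V) / log 2) * (2 * 2 ^ d / γ))) *
        ∫⁻ x in S ∩ Set.univ.pi fun _ => Set.Ico 0 P, ‖Φ (fun j => (x j : ℂ))‖ₑ ^ p := by
  choose N ℓ hN haℓ hℓa using fun j => exists_nat_mul_eq_of_le (ha j) (haP j)
  have hℓ : ∀ j, 0 < ℓ j := fun j => (ha j).trans_le (haℓ j)
  set C : Set (Fin d → ℝ) := Set.univ.pi fun _ => Set.Ico 0 P with hC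
  have hCm : MeasurableSet C := MeasurableSet.univ_pi fun _ => measurableSet_Ico
  set g : (Fin d → ℝ) → ENNReal := fun x => ‖Φ (fun j => (x j : ℂ))‖ₑ ^ p with hg
  set Q : (Fin d → ℕ) → Set (Fin d → ℝ) :=
    fun q => Set.univ.pi fun j => Set.Ico (q j * ℓ j) (q j * ℓ j + ℓ j) with hQ
  have hQm : ∀ q, MeasurableSet (Q q) := fun q => MeasurableSet.univ_pi fun _ => measurableSet_Ico
  have hsplit := fun (ν : Measure (Fin d → ℝ)) f => setLIntegral_cube_eq_sum hℓ hN ν f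
  set K : ℝ := (48 * 8 ^ d / γ) ^ (log (2 * V) / log 2) * (2 * 2 ^ d / γ) with hK
  have hK0 : 0 ≤ K := by positivity
  set W : ENNReal := ENNReal.ofReal (2 * V) with hW
  have hW0 : W ≠ 0 := (ENNReal.ofReal_pos.2 (by linarith)).ne'
  have hWt : W ≠ ⊤ := ENNReal.ofReal_ne_top
  set T := Fintype.piFinset fun j => Finset.range (N j) with hT
  have hsumg : ∫⁻ x in C, g x = ∑ q ∈ T, ∫⁻ x in Q q, g x := hsplit volume g
  have hsumG : ∫⁻ x in C, G x ^ p = ∑ q ∈ T, ∫⁻ x in Q q, G x ^ p := hsplit volume _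
  have hsumS : ∫⁻ x in S ∩ C, g x = ∑ q ∈ T, ∫⁻ x in S ∩ Q q, g x := by
    have h1 := hsplit (volume.restrict S) g
    rw [Measure.restrict_restrict hCm, Set.inter_comm] at h1
    rw [h1]
    refine Finset.sum_congr rfl fun q _ => ?_
    rw [Measure.restrict_restrict (hQm q), Set.inter_comm]
  have htile : ∀ q ∈ T, ∫⁻ x in Q q, g x ≤
      (ENNReal.ofReal K * ∫⁻ x in S ∩ Q q, g x) + W⁻¹ * ∫⁻ x in Q q, G x ^ p := by
    intro q hq
    by_cases hgood : ∫⁻ x in Q q, G x ^ p ≤ W * ∫⁻ x in Q q, g x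
    · refine le_add_right ?_
      have hfinq : ∫⁻ x in Q q, g x ≠ ⊤ := by
        refine ne_top_of_le_ne_top hfin ?_
        change _ ≤ ∫⁻ x in C, g x
        rw [hsumg]
        exact Finset.single_le_sum (f := fun q => ∫⁻ x in Q q, g x)
          (fun _ _ => zero_le (α := ENNReal)) hq
      have h1 := lintegral_tile_le hℓ (α := fun j => q j * ℓ j) rfl hS (γ := γ / 2 ^ d)
        (by positivity)
        ((div_le_self hγ.le (one_le_pow₀ (by norm_num))).trans hγ1)
        (ofReal_le_measure_inter_tile ha haℓ hℓa hγ hthick _) hΦ hG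
        (fun x w hw => hΦG x w fun j => (hw j).trans (by linarith [hℓa j])) hp
        (W := 2 * V) (by linarith) hfinq hgood
      have e1 : 48 * 4 ^ d / (γ / 2 ^ d) = 48 * 8 ^ d / γ := by
        rw [show (8 : ℝ) = 4 * 2 by norm_num, mul_pow]
        field_simp
      have e2 : 2 / (γ / 2 ^ d) = 2 * 2 ^ d / γ := by field_simp
      rw [e1, e2] at h1
      exact h1
    · refine le_add_left ?_
      rw [← ENNReal.mul_le_iff_le_inv hW0 hWt]
      exact (not_le.1 hgood).le
  have hmain : ∫⁻ x in C, g x ≤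
      (ENNReal.ofReal K * ∫⁻ x in S ∩ C, g x) + (∫⁻ x in C, g x) / 2 := by
    calc ∫⁻ x in C, g x = ∑ q ∈ T, ∫⁻ x in Q q, g x := hsumg
      _ ≤ _ := Finset.sum_le_sum htile
      _ = (ENNReal.ofReal K * ∫⁻ x in S ∩ C, g x) + W⁻¹ * ∫⁻ x in C, G x ^ p := by
        rw [Finset.sum_add_distrib, ← Finset.mul_sum, ← Finset.mul_sum, ← hsumS, ← hsumG]
      _ ≤ (ENNReal.ofReal K * ∫⁻ x in S ∩ C, g x) +
          W⁻¹ * (ENNReal.ofReal V * ∫⁻ x in C, g x) := by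
        gcongr
      _ = _ := by
        have hV0 : ENNReal.ofReal V ≠ 0 := (ENNReal.ofReal_pos.2 (by linarith)).ne'
        rw [hW, ENNReal.ofReal_mul zero_le_two, ENNReal.ofReal_ofNat,
          ENNReal.mul_inv (Or.inl two_ne_zero) (Or.inl (by norm_num)), mul_assoc,
          ← mul_assoc (ENNReal.ofReal V)⁻¹, ENNReal.inv_mul_cancel hV0 ENNReal.ofReal_ne_top,
          one_mul, ENNReal.div_eq_inv_mul]
  have hhalf : (∫⁻ x in C, g x) / 2 ≤ ENNReal.ofReal K * ∫⁻ x in S ∩ C, g x := by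
    have h1 : (∫⁻ x in C, g x) / 2 + (∫⁻ x in C, g x) / 2 ≤
        (ENNReal.ofReal K * ∫⁻ x in S ∩ C, g x) + (∫⁻ x in C, g x) / 2 := by
      rwa [ENNReal.add_halves]
    exact (ENNReal.add_le_add_iff_right (ENNReal.div_ne_top hfin two_ne_zero)).1 h1
  rw [ENNReal.ofReal_mul zero_le_two, ENNReal.ofReal_ofNat, mul_assoc]
  rwa [ENNReal.div_le_iff two_ne_zero (by norm_num), mul_comm _ 2] at hhalf

theorem norm_trigPoly_eq_norm_expSum {d : ℕ} (L : ℝ) (T : Finset (Fin d → ℤ))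
    (F : (Fin d → ℤ) → ℂ) (lam : Fin d → ℝ) (x : Fin d → ℝ) :
    ‖trigPoly L T F x‖ = ‖expSum T (fun k j => k j / L - lam j) F (fun j => (x j : ℂ))‖ := by
  have h1 : trigPoly L T F x = Complex.exp (((∑ j, lam j * x j : ℝ) : ℂ) * Complex.I) *
      expSum T (fun k j => k j / L - lam j) F (fun j => (x j : ℂ)) := by
    rw [trigPoly, expSum, Finset.mul_sum]
    refine Finset.sum_congr rfl fun k _ => ?_
    rw [mul_left_comm, ← Complex.exp_add]
    congr 2
    rw [mul_comm _ Complex.I, ← mul_add]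
    congr 1
    push_cast
    rw [← Finset.sum_add_distrib]
    exact Finset.sum_congr rfl fun j _ => by ring
  rw [h1, norm_mul, Complex.norm_exp_ofReal_mul_I, one_mul]

theorem trigPoly_add_period {d : ℕ} {L : ℝ} (hL : 0 < L) (T : Finset (Fin d → ℤ))
    (F : (Fin d → ℤ) → ℂ) (n : Fin d → ℤ) (x : Fin d → ℝ) :
    trigPoly L T F (fun j => x j + n j * (2 * π * L)) = trigPoly L T F x := by
  rw [trigPoly, trigPoly]
  refine Finset.sum_congr rfl fun k _ => ?_
  congr 1
  have h1 : ∑ j, (x j + n j * (2 * π * L)) * k j / L =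
      ∑ j, x j * k j / L + ((∑ j, n j * k j : ℤ) : ℝ) * (2 * π) := by
    push_cast
    rw [Finset.sum_mul, ← Finset.sum_add_distrib]
    exact Finset.sum_congr rfl fun j _ => by field_simp
  rw [h1]
  have h2 : Complex.I * ((∑ j, x j * k j / L + ((∑ j, n j * k j : ℤ) : ℝ) * (2 * π) : ℝ) : ℂ) =
      Complex.I * ((∑ j, x j * k j / L : ℝ) : ℂ) +
        ((∑ j, n j * k j : ℤ) : ℂ) * (2 * π * Complex.I) := by
    push_cast
    ring
  rw [h2, Complex.exp_add, Complex.exp_int_mul_two_pi_mul_I, mul_one]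

theorem torusCube_ae_eq (d : ℕ) (L : ℝ) :
    (Set.univ.pi fun _ : Fin d => Set.Ico (0 : ℝ) (2 * π * L)) =ᵐ[volume] torusCube d L := by
  have := Measure.univ_pi_Ico_ae_eq_Icc (μ := fun _ : Fin d => (volume : Measure ℝ))
    (f := fun _ => 0) (g := fun _ => 2 * π * L)
  rwa [← Set.pi_univ_Icc] at this

theorem tile_constant_le {d : ℕ} (hd : 1 ≤ d) {γ : ℝ} (hγ : 0 < γ) (hγ1 : γ ≤ 1) {p : ℝ}
    (hp : 1 ≤ p) {s : ℝ} (hs : 0 ≤ s) :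
    2 * ((48 * 8 ^ d / γ) ^ (log (2 * Real.exp (p * (28 / 3 * s))) / log 2) * (2 * 2 ^ d / γ)) ≤
      ((400 ^ d / γ) ^ (400 * s + (6 * (d : ℝ) + 1) * (1 / p))) ^ p := by
  have hp0 : 0 < p := by linarith
  set X : ℝ := 400 ^ d / γ with hX
  have h48 : (48 * 8 ^ d : ℝ) ≤ 400 ^ d := by
    have h1 : (48 : ℝ) ≤ 48 ^ d := le_self_pow₀ (by norm_num) (by omega)
    calc (48 * 8 ^ d : ℝ) ≤ 48 ^ d * 8 ^ d := by gcongr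
      _ = 384 ^ d := by rw [← mul_pow]; norm_num
      _ ≤ 400 ^ d := by gcongr; norm_num
  have h8 : (1 : ℝ) ≤ 8 ^ d := one_le_pow₀ (by norm_num)
  have h28 : (2 : ℝ) ^ d ≤ 8 ^ d := by gcongr; norm_num
  have h1 : 48 * 8 ^ d / γ ≤ X := by rw [hX]; gcongr
  have h2 : 2 * (2 * 2 ^ d / γ) ≤ X := by
    rw [hX, ← mul_div_assoc]
    gcongr
    linarith
  have hB1 : 1 ≤ 48 * 8 ^ d / γ := by
    rw [le_div_iff₀ hγ]
    linarith
  have hX1 : 1 ≤ X := hB1.trans h1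
  have hlog2 : 0.69 ≤ log 2 := by linarith [Real.log_two_gt_d9]
  have hlog : log (2 * Real.exp (p * (28 / 3 * s))) / log 2 ≤ 1 + 14 * (p * s) := by
    have hps : 0 ≤ p * s := by positivity
    rw [Real.log_mul two_ne_zero (Real.exp_pos _).ne', Real.log_exp, div_le_iff₀ (by linarith)]
    nlinarith
  have hd' : (1 : ℝ) ≤ d := by exact_mod_cast hd
  calc 2 * ((48 * 8 ^ d / γ) ^ (log (2 * Real.exp (p * (28 / 3 * s))) / log 2) * (2 * 2 ^ d / γ))
      = (48 * 8 ^ d / γ) ^ (log (2 * Real.exp (p * (28 / 3 * s))) / log 2) *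
          (2 * (2 * 2 ^ d / γ)) := by ring
    _ ≤ (48 * 8 ^ d / γ) ^ (1 + 14 * (p * s)) * X := by gcongr
    _ ≤ X ^ (1 + 14 * (p * s)) * X := by gcongr
    _ = X ^ (1 + 14 * (p * s) + 1) := by rw [Real.rpow_add_one (by positivity)]
    _ ≤ X ^ ((400 * s + (6 * (d : ℝ) + 1) * (1 / p)) * p) := by
      refine Real.rpow_le_rpow_of_exponent_le hX1 ?_
      have hps : 0 ≤ p * s := by positivity
      rw [add_mul, mul_assoc (6 * (d : ℝ) + 1), one_div_mul_cancel hp0.ne']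
      nlinarith
    _ = _ := Real.rpow_mul (by positivity) _ _

theorem continuous_trigPoly {d : ℕ} (L : ℝ) (T : Finset (Fin d → ℤ)) (F : (Fin d → ℤ) → ℂ) :
    Continuous (trigPoly L T F) := by
  unfold trigPoly
  fun_prop

theorem norm_trigPoly_le {d : ℕ} (L : ℝ) (T : Finset (Fin d → ℤ)) (F : (Fin d → ℤ) → ℂ)
    (x : Fin d → ℝ) : ‖trigPoly L T F x‖ ≤ ∑ k ∈ T, ‖F k‖ := by
  refine (norm_sum_le _ _).trans (Finset.sum_le_sum fun k _ => ?_)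
  rw [norm_mul, mul_comm Complex.I, Complex.norm_exp_ofReal_mul_I, mul_one]

theorem isCompact_torusCube (d : ℕ) (L : ℝ) : IsCompact (torusCube d L) :=
  isCompact_univ_pi fun _ => isCompact_Icc

theorem eLpNorm_trigPoly_torusCube_le {d : ℕ} (hd : 1 ≤ d) {L : ℝ} (hL : 0 < L) {p : ENNReal}
    (hp : 1 ≤ p) (hpt : p ≠ ⊤) {b a : Fin d → ℝ} (hb : ∀ j, 0 < b j)
    (ha : ∀ j, 0 < a j ∧ a j ≤ 2 * π * L) {γ : ℝ} (hγ : 0 < γ) (hγ1 : γ ≤ 1)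
    {S : Set (Fin d → ℝ)} (hS : MeasurableSet S)
    (hthick : ∀ x : Fin d → ℝ,
      volume (S ∩ Set.univ.pi fun i => Set.Icc (x i) (x i + a i)) ≥ ENNReal.ofReal (γ * ∏ i, a i))
    {lam : Fin d → ℝ} {T : Finset (Fin d → ℤ)} (F : (Fin d → ℤ) → ℂ)
    (hT : ∀ k ∈ T, ∀ j, (k j : ℝ) / L ∈ Set.Icc (lam j - b j / 2) (lam j + b j / 2)) :
    eLpNorm (trigPoly L T F) p (volume.restrict (torusCube d L)) ≤
      ENNReal.ofReal ((400 ^ d / γ) ^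
          (400 * (∑ j, a j * b j) + (6 * (d : ℝ) + 1) * (1 / p).toReal)) *
        eLpNorm (trigPoly L T F) p (volume.restrict (S ∩ torusCube d L)) := by
  set C : Set (Fin d → ℝ) := Set.univ.pi fun _ : Fin d => Set.Ico (0 : ℝ) (2 * π * L) with hC
  have hcube : volume.restrict (torusCube d L) = volume.restrict C :=
    Measure.restrict_congr_set (torusCube_ae_eq d L).symm
  have hcubeS : volume.restrict (S ∩ torusCube d L) = volume.restrict (S ∩ C) :=
    Measure.restrict_congr_set ((Filter.EventuallyEq.refl _ S).inter (torusCube_ae_eq d L)).symm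
  rw [hcube, hcubeS]
  set μ : (Fin d → ℤ) → Fin d → ℝ := fun k j => k j / L - lam j with hμdef
  have hnorm : ∀ x : Fin d → ℝ, ‖trigPoly L T F x‖ₑ = ‖expSum T μ F (fun j => (x j : ℂ))‖ₑ :=
    fun x => by
      rw [← ofReal_norm, ← ofReal_norm, norm_trigPoly_eq_norm_expSum L T F lam]
  have hp0 : p ≠ 0 := (zero_lt_one.trans_le hp).ne'
  set q : ℝ := p.toReal with hq
  have hq1 : 1 ≤ q := by
    rw [hq, ← ENNReal.toReal_one]
    exact ENNReal.toReal_mono hpt hp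
  have hq0 : 0 < q := by linarith
  have hpq : (1 / p).toReal = 1 / q := by
    rw [ENNReal.toReal_div, ENNReal.toReal_one]
  rw [eLpNorm_eq_lintegral_rpow_enorm_toReal hp0 hpt,
    eLpNorm_eq_lintegral_rpow_enorm_toReal hp0 hpt, hpq]
  simp only [hnorm]
  set s : ℝ := ∑ j, a j * b j with hs
  have hd0 : (Finset.univ : Finset (Fin d)).Nonempty := ⟨⟨0, hd⟩, Finset.mem_univ _⟩
  have hs0 : 0 < s := Finset.sum_pos (fun j _ => mul_pos (ha j).1 (hb j)) hd0
  have hA : ∑ j, 14 * a j * (4 * (b j / 2) / 3) = 28 / 3 * s := by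
    rw [hs, Finset.mul_sum]
    exact Finset.sum_congr rfl fun j _ => by ring
  obtain ⟨G, hGm, hG, hGint⟩ := exists_growth_majorant (T := T) (μ := μ) (F := F)
    (σ := fun j => b j / 2) (ρ := fun j => 14 * a j) (fun j => by have := hb j; positivity)
    (fun j => by have := (ha j).1; positivity)
    (fun k hk j => by
      obtain ⟨h1, h2⟩ := hT k hk j
      simp only [hμdef]
      rw [abs_le]
      constructor <;> linarith)
    (P := 2 * π * L) (by positivity)
    (fun n x => by rw [← hnorm, ← hnorm, trigPoly_add_period hL])
    (by rw [hA]; positivity) hq1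
  rw [hA] at hGint
  have hfin : ∫⁻ x in C, ‖expSum T μ F (fun j => (x j : ℂ))‖ₑ ^ q ≠ ⊤ := by
    rw [← hcube]
    have hvol : volume (torusCube d L) ≠ ⊤ := (isCompact_torusCube d L).measure_lt_top.ne
    refine ne_top_of_le_ne_top (ENNReal.mul_ne_top (ENNReal.rpow_ne_top_of_nonneg hq0.le
      (ENNReal.ofReal_ne_top (r := ∑ k ∈ T, ‖F k‖))) hvol) ?_
    rw [← setLIntegral_const]
    refine lintegral_mono fun x => ENNReal.rpow_le_rpow ?_ hq0.le
    rw [← hnorm, ← ofReal_norm]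
    exact ENNReal.ofReal_le_ofReal (norm_trigPoly_le L T F x)
  have hmain := setLIntegral_cube_le (fun j => (ha j).1) (fun j => (ha j).2) hγ hγ1 hS hthick
    (differentiable_expSum T μ F) hGm hG hq0 (Real.one_le_exp (by positivity)) hfin hGint
  have hconst := ENNReal.ofReal_le_ofReal (tile_constant_le hd hγ hγ1 hq1 hs0.le)
  have hpos : 0 < (400 ^ d / γ) ^ (400 * s + (6 * (d : ℝ) + 1) * (1 / q)) := by positivity
  rw [← ENNReal.ofReal_rpow_of_pos hpos] at hconst
  have h1 := ENNReal.rpow_le_rpow (hmain.trans (mul_le_mul_left hconst _))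
    (by positivity : 0 ≤ 1 / q)
  refine h1.trans (le_of_eq ?_)
  rw [ENNReal.mul_rpow_of_nonneg _ _ (by positivity), ← ENNReal.rpow_mul,
    mul_one_div_cancel hq0.ne', ENNReal.rpow_one]

theorem ENNReal.tendsto_rpow_one_div_atTop {a : ENNReal} (h0 : a ≠ 0) (ht : a ≠ ⊤) :
    Filter.Tendsto (fun q : ℝ => a ^ (1 / q)) Filter.atTop (nhds 1) := by
  have ha : 0 < a.toReal := ENNReal.toReal_pos h0 ht
  have h1 : Filter.Tendsto (fun q : ℝ => 1 / q) Filter.atTop (nhds 0) := by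
    simpa using tendsto_inv_atTop_zero (𝕜 := ℝ)
  have h2 := (Real.continuousAt_const_rpow ha.ne' (b := 0)).tendsto.comp h1
  have h3 := ENNReal.tendsto_ofReal h2
  rw [Real.rpow_zero, ENNReal.ofReal_one] at h3
  refine h3.congr fun q => ?_
  rw [Function.comp_apply, ← ENNReal.ofReal_rpow_of_pos ha, ENNReal.ofReal_toReal ht]

/-- Passing to the limit `p → ∞` in an inequality between `L^p` norms. -/
theorem eLpNorm_top_le_of_forall_eLpNorm_le {X E : Type*} [MeasurableSpace X]
    [NormedAddCommGroup E] {μ ν : Measure X} [IsFiniteMeasure μ] [IsFiniteMeasure ν] {f : X → E}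
    (hfμ : AEStronglyMeasurable f μ) (hfν : AEStronglyMeasurable f ν) {K : ℝ → ENNReal}
    {K' : ENNReal} (hK : Filter.Tendsto K Filter.atTop (nhds K')) (hK' : K' ≠ ⊤)
    (hM : eLpNorm f ⊤ ν ≠ ⊤)
    (h : ∀ q : ℝ, 1 ≤ q →
      eLpNorm f (ENNReal.ofReal q) μ ≤ K q * eLpNorm f (ENNReal.ofReal q) ν) :
    eLpNorm f ⊤ μ ≤ K' * eLpNorm f ⊤ ν := by
  refine le_of_forall_lt fun t ht => ?_
  obtain ⟨t', htt', ht'⟩ := exists_between ht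
  refine htt'.trans_le ?_
  set m := μ {x | t' ≤ ‖f x‖ₑ} with hm
  have hm0 : m ≠ 0 := by
    intro h0
    refine (not_le.2 ht') ?_
    rw [eLpNorm_exponent_top]
    refine essSup_le_of_ae_le _ ?_
    have h1 : ∀ᵐ x ∂μ, ¬ t' ≤ ‖f x‖ₑ := by
      rw [ae_iff]
      simpa using h0
    filter_upwards [h1] with x hx using (not_le.1 hx).le
  have hmt : m ≠ ⊤ := measure_ne_top _ _
  have hbound : ∀ q : ℝ, 1 ≤ q →
      t' * m ^ (1 / q) ≤ K q * (eLpNorm f ⊤ ν * (ν Set.univ + 1) ^ (1 / q)) := by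
    intro q hq
    have hq0 : 0 < q := by linarith
    have hqE : ENNReal.ofReal q ≠ 0 := (ENNReal.ofReal_pos.2 hq0).ne'
    have hqR : (ENNReal.ofReal q).toReal = q := ENNReal.toReal_ofReal hq0.le
    have h1 := mul_meas_ge_le_pow_eLpNorm' μ hqE ENNReal.ofReal_ne_top hfμ t'
    rw [hqR] at h1
    have h2 : t' * m ^ (1 / q) ≤ eLpNorm f (ENNReal.ofReal q) μ := by
      rw [← ENNReal.rpow_le_rpow_iff hq0, ENNReal.mul_rpow_of_nonneg _ _ hq0.le, ← ENNReal.rpow_mul,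
        one_div_mul_cancel hq0.ne', ENNReal.rpow_one]
      exact h1
    have h3 := eLpNorm_le_eLpNorm_mul_rpow_measure_univ (le_top (a := ENNReal.ofReal q)) hfν
    rw [hqR, ENNReal.toReal_top, div_zero, sub_zero] at h3
    refine h2.trans ((h q hq).trans ?_)
    gcongr
    refine h3.trans ?_
    gcongr
    exact le_self_add
  have hlim1 : Filter.Tendsto (fun q : ℝ => t' * m ^ (1 / q)) Filter.atTop (nhds (t' * 1)) :=
    ENNReal.Tendsto.const_mul (ENNReal.tendsto_rpow_one_div_atTop hm0 hmt) (Or.inl one_ne_zero)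
  have hlim2 : Filter.Tendsto (fun q : ℝ => K q * (eLpNorm f ⊤ ν * (ν Set.univ + 1) ^ (1 / q)))
      Filter.atTop (nhds (K' * (eLpNorm f ⊤ ν * 1))) := by
    refine ENNReal.Tendsto.mul hK (Or.inr ?_) ?_ (Or.inr hK')
    · rwa [mul_one]
    · exact ENNReal.Tendsto.const_mul (ENNReal.tendsto_rpow_one_div_atTop (by simp)
        (by simp [measure_ne_top])) (Or.inl one_ne_zero)
  have := le_of_tendsto_of_tendsto hlim1 hlim2
    ((Filter.eventually_ge_atTop 1).mono fun q hq => hbound q hq)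
  simpa using this

/-- Logvinenko–Sereda theorem on the torus, single parallelepiped: there is a universal
constant `c > 0` such that for `f ∈ L^p(T^d_L)`, `p ∈ [1,∞]`, with Fourier coefficients
supported in an axis-parallel parallelepiped `J` with sides `b_1,…,b_d`, and any
`(γ,a)`-thick set `S` with `a_j ≤ 2πL`,
`‖f‖_{L^p(T^d_L)} ≤ (c^d/γ)^{c a·b + (6d+1)/p} ‖f‖_{L^p(S ∩ T^d_L)}`
(for `p = ∞` the term `(6d+1)/p` vanishes). -/
theorem stmt_12 :
    ∃ c : ℝ, 0 < c ∧
      ∀ (d : ℕ), 1 ≤ d → ∀ L : ℝ, 0 < L → ∀ p : ENNReal, 1 ≤ p →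
        ∀ b a : Fin d → ℝ, (∀ j, 0 < b j) → (∀ j, 0 < a j ∧ a j ≤ 2 * π * L) →
          ∀ γ : ℝ, 0 < γ → γ ≤ 1 →
            ∀ S : Set (Fin d → ℝ), MeasurableSet S →
              (∀ x : Fin d → ℝ,
                volume (S ∩ Set.univ.pi fun i => Set.Icc (x i) (x i + a i)) ≥
                  ENNReal.ofReal (γ * ∏ i, a i)) →
              ∀ (lam : Fin d → ℝ) (T : Finset (Fin d → ℤ)) (F : (Fin d → ℤ) → ℂ),
                (∀ k ∈ T, ∀ j,
                  (k j : ℝ) / L ∈ Set.Icc (lam j - b j / 2) (lam j + b j / 2)) →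
                eLpNorm (trigPoly L T F) p (volume.restrict (torusCube d L)) ≤
                  ENNReal.ofReal ((c ^ d / γ) ^
                      (c * (∑ j, a j * b j) + (6 * (d : ℝ) + 1) * (1 / p).toReal)) *
                    eLpNorm (trigPoly L T F) p (volume.restrict (S ∩ torusCube d L)) := by
  refine ⟨400, by norm_num, ?_⟩
  intro d hd L hL p hp b a hb ha γ hγ hγ1 S hS hthick lam T F hT
  rcases eq_or_ne p ⊤ with rfl | hpt
  · have hcube : volume (torusCube d L) < ⊤ := (isCompact_torusCube d L).measure_lt_top
    have hfin1 : IsFiniteMeasure (volume.restrict (torusCube d L)) :=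
      ⟨by rwa [Measure.restrict_apply_univ]⟩
    have hfin2 : IsFiniteMeasure (volume.restrict (S ∩ torusCube d L)) :=
      ⟨by
        rw [Measure.restrict_apply_univ]
        exact (measure_mono Set.inter_subset_right).trans_lt hcube⟩
    have hm := (continuous_trigPoly L T F).stronglyMeasurable
    have hX : (400 ^ d / γ : ℝ) ≠ 0 := by positivity
    refine eLpNorm_top_le_of_forall_eLpNorm_le (K := fun q => ENNReal.ofReal ((400 ^ d / γ) ^
        (400 * (∑ j, a j * b j) + (6 * (d : ℝ) + 1) * (1 / q)))) hm.aestronglyMeasurable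
      hm.aestronglyMeasurable ?_ ENNReal.ofReal_ne_top ?_ fun q hq => ?_
    · have h1 : Filter.Tendsto (fun q : ℝ => 1 / q) Filter.atTop (nhds 0) := by
        simpa using tendsto_inv_atTop_zero (𝕜 := ℝ)
      have h2 := (h1.const_mul (6 * (d : ℝ) + 1)).const_add (400 * (∑ j, a j * b j))
      have h3 : (1 / (⊤ : ENNReal)).toReal = 0 := by simp
      rw [h3]
      exact ENNReal.tendsto_ofReal ((Real.continuousAt_const_rpow hX).tendsto.comp h2)
    · rw [eLpNorm_exponent_top]
      exact (eLpNormEssSup_lt_top_of_ae_bound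
        (Filter.Eventually.of_forall (norm_trigPoly_le L T F))).ne
    · have h1 := eLpNorm_trigPoly_torusCube_le hd hL (p := ENNReal.ofReal q)
        (by rwa [ENNReal.one_le_ofReal]) ENNReal.ofReal_ne_top hb ha hγ hγ1 hS hthick F hT
      rwa [ENNReal.toReal_div, ENNReal.toReal_one, ENNReal.toReal_ofReal (by linarith)] at h1
  · exact eLpNorm_trigPoly_torusCube_le hd hL hp hpt hb ha hγ hγ1 hS hthick F hT
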